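/- arXiv:1009.0148 — 4 statements merged into one kernel-verified Lean document; each statement's English description precedes it below -/
import Mathlib

section
/- Let F be an ordinary differential field of characteristic zero, E a differential field extension of F, and ξ = (ξ_1,…,ξ_n) ∈ E^n of differential dimension d and order h over F. Let u_{σρ} (0 ≤ σ ≤ d, 1 ≤ ρ ≤ n) be elements of E that are differentially independent over F⟨ξ_1,…,ξ_n⟩, set ζ_σ = −Σ_{ρ=1}^n u_{σρ} ξ_ρ, and let K = F⟨u_{σρ} : 0 ≤ σ ≤ d, 1 ≤ ρ ≤ n⟩. Then the transcendence degree of the field K⟨ζ_0, ζ_1, …, ζ_d⟩ over the field K⟨ζ_1, …, ζ_d⟩ equals h. (This expresses that the order of the differential Chow form of an irreducible differential variety of dimension d and order h is equal to h.) -/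
set_option synthInstance.maxHeartbeats 1000000
set_option maxHeartbeats 1000000

open Cardinal in
/-- The transcendence degree of an algebra `L` over `K`: the supremum of the
cardinalities of algebraically independent subsets of `L` over `K`. -/
noncomputable def Trdeg (K L : Type*) [CommRing K] [CommRing L] [Algebra K L] : Cardinal :=
  ⨆ s : { s : Set L // AlgebraicIndependent K ((↑) : s → L) }, #s.1

/-- A family `a : ι → E` is differentially independent over a subfield `K` of `E`
(w.r.t. a derivation `δ`) if the family of all its iterated derivatives is
algebraically independent over `K`. -/
def DiffIndep {E : Type*} [Field E] (δ : E → E) (K : Subfield E)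
    {ι : Type*} (a : ι → E) : Prop :=
  AlgebraicIndependent K (fun p : ι × ℕ => δ^[p.2] (a p.1))

/-- The differential subfield `F⟨S⟩` of `E` generated by `F` and `S`. -/
def diffAdjoin {E : Type*} [Field E] (δ : E → E) (F : Subfield E) (S : Set E) : Subfield E :=
  Subfield.closure (↑F ∪ {x | ∃ s ∈ S, ∃ k : ℕ, δ^[k] s = x})

/-- `ξ ∈ Eⁿ` has differential dimension `d` and order `h` over `F`: for all sufficiently
large `t`, the transcendence degree over `F` of `F(δʲξᵢ : 1 ≤ i ≤ n, 0 ≤ j ≤ t)`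
equals `d(t+1) + h`. -/
def HasDimOrder {E : Type*} [Field E] (δ : E → E) (F : Subfield E)
    {n : ℕ} (ξ : Fin n → E) (d h : ℕ) : Prop :=
  ∃ T : ℕ, ∀ t : ℕ, T ≤ t →
    Trdeg F (IntermediateField.adjoin F {x : E | ∃ i : Fin n, ∃ j ≤ t, δ^[j] (ξ i) = x})
      = ((d * (t + 1) + h : ℕ) : Cardinal)

namespace Matroid
open Set
variable {α : Type*} {M : Matroid α} {A I U X Y : Set α}

theorem eRk_union_eq_eRk_add_eRk_contract (M : Matroid α) (X Y : Set α) :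
    M.eRk (X ∪ Y) = M.eRk X + (M ／ X).eRk Y := by
  obtain ⟨I, hI⟩ := M.exists_isBasis' X
  obtain ⟨J, hJ⟩ := (M ／ X).exists_isBasis' Y
  obtain ⟨hJI, hXJ⟩ := hI.contract_indep_iff.1 hJ.indep
  have hle : M.eRk (X ∪ Y) ≤ M.eRk (I ∪ J) := by
    rw [hI.eRk_eq_eRk_union J, ← eRk_inter_ground, ← eRk_closure_eq M (X ∪ J)]
    refine M.eRk_mono fun x ⟨hx, hxE⟩ ↦ ?_
    by_cases hxX : x ∈ X
    · exact M.mem_closure_of_mem' (.inl hxX) hxE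
    · have := hJ.isBasis_inter_ground.subset_closure ⟨hx.resolve_left hxX, hxE, hxX⟩
      rw [contract_closure_eq, union_comm] at this
      exact this.1
  have hIJ : M.Indep (I ∪ J) := union_comm J I ▸ hJI
  rw [hI.eRk_eq_encard, hJ.eRk_eq_encard, ← encard_union_eq (hXJ.mono_left hI.subset),
    ← hIJ.eRk_eq_encard]
  exact hle.antisymm <| hI.eRk_eq_eRk_union J ▸ M.eRk_mono (union_subset_union_right X hJ.subset)

theorem eRk_contract_le (M : Matroid α) (A X : Set α) : (M ／ A).eRk X ≤ M.eRk X := by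
  rw [eRk_le_iff]
  exact fun I hIX hI ↦ hI.of_contract.encard_le_eRk_of_subset hIX

theorem eRk_contract_eq_of_indep_contract (h : (M ／ X).Indep U) :
    (M ／ U).eRk X = M.eRk X := by
  refine le_antisymm (M.eRk_contract_le U X) ?_
  obtain ⟨I, hI⟩ := M.exists_isBasis' X
  obtain ⟨hUI, hXU⟩ := hI.contract_indep_iff.1 h
  rw [hI.eRk_eq_encard]
  refine Indep.encard_le_eRk_of_subset ?_ hI.subset
  rw [(hUI.subset subset_union_left).contract_indep_iff, union_comm]
  exact ⟨hXU.mono_left hI.subset, hUI⟩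

theorem eRk_contract_le_of_subset_closure (h : X ⊆ M.closure (A ∪ Y)) :
    (M ／ A).eRk X ≤ (M ／ A).eRk Y := by
  rw [← eRk_closure_eq _ Y, contract_closure_eq, ← eRk_inter_ground]
  refine eRk_mono _ fun x hx ↦ ⟨union_comm A Y ▸ h hx.1, hx.2.2⟩

theorem contract_indep_iff_forall_notMem_closure (hI : I ⊆ M.E) :
    (M ／ A).Indep I ↔ ∀ x ∈ I, x ∉ M.closure (A ∪ I \ {x}) := by
  rw [indep_iff_forall_notMem_closure_sdiff']
  simp only [contract_closure_eq, contract_ground, mem_sdiff, not_and, not_not, union_comm A]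
  constructor
  · exact fun ⟨h1, h2⟩ x hx hx' ↦ (h1 hx).2 (h2 x hx hx')
  · refine fun h ↦ ⟨fun x hx ↦ ⟨hI hx, fun hxA ↦ h x hx ?_⟩, fun x hx hx' ↦ (h x hx hx').elim⟩
    exact M.mem_closure_of_mem' (.inr hxA) (hI hx)

theorem contract_indep_range_of_forall_notMem_closure [Finitary M] {z : ℕ → α}
    (hz : range z ⊆ M.E) (h : ∀ k, z k ∉ M.closure (A ∪ z '' Iio k)) :
    (M ／ A).Indep (range z) := by
  have hk (k : ℕ) : (M ／ A).Indep (z '' Iio k) := by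
    induction k with
    | zero => simp
    | succ k ih =>
      have : z '' Iio (k + 1) = insert (z k) (z '' Iio k) := by
        rw [← image_insert_eq, Iio_insert]; congr 1; ext; simp
      rw [this, insert_indep_iff]
      refine ⟨ih, fun _ ↦ ?_⟩
      rw [contract_closure_eq, contract_ground, union_comm]
      refine ⟨⟨hz ⟨k, rfl⟩, fun hA ↦ h k ?_⟩, fun hc ↦ h k hc.1⟩
      exact M.mem_closure_of_mem' (.inl hA) (hz ⟨k, rfl⟩)
  refine indep_of_forall_finite_subset_indep _ fun J hJ hfin ↦ ?_
  obtain ⟨t, ht, rfl⟩ := (subset_range_iff_exists_image_eq.1 hJ)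
  obtain ⟨t', ht', hbij⟩ := (surjOn_image z t).exists_bijOn_subset
  rw [← hbij.image_eq] at hfin ⊢
  obtain ⟨b, hb⟩ := (hfin.of_finite_image hbij.injOn).bddAbove
  exact (hk (b + 1)).subset (image_mono fun x hx ↦ Order.lt_add_one_iff.2 (hb hx))

theorem eRk_contract_image_Iio_of_forall_notMem_closure [Finitary M] {z : ℕ → α}
    (hz : range z ⊆ M.E) (h : ∀ k, z k ∉ M.closure (A ∪ z '' Iio k)) (m : ℕ) :
    (M ／ A).eRk (z '' Iio m) = m := by
  have hlt {j k : ℕ} (hjk : j < k) : z j ≠ z k := fun hz' ↦ h k <| hz' ▸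
    M.mem_closure_of_mem' (.inr ⟨j, hjk, rfl⟩) (hz ⟨j, rfl⟩)
  have hinj : Function.Injective z := fun j k hjk ↦ by
    by_contra hne
    obtain hlt' | hlt' := lt_or_gt_of_ne hne
    exacts [hlt hlt' hjk, hlt hlt' hjk.symm]
  have hind := (contract_indep_range_of_forall_notMem_closure hz h).subset
    (image_subset_range z (Iio m))
  rw [hind.eRk_eq_encard, hinj.encard_image, ← Finset.coe_Iio, encard_coe_eq_coe_finsetCard,
    Nat.card_Iio]

theorem eRk_contract_union (M : Matroid α) (A X Y : Set α) :
    (M ／ A).eRk (X ∪ Y) = (M ／ A).eRk X + (M ／ (A ∪ X)).eRk Y := by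
  rw [eRk_union_eq_eRk_add_eRk_contract, contract_contract]

theorem eRk_contract_union_eq_of_indep (h : (M ／ (A ∪ X)).Indep U) :
    (M ／ (A ∪ U)).eRk X = (M ／ A).eRk X := by
  rw [← contract_contract] at h ⊢
  exact eRk_contract_eq_of_indep_contract h

end Matroid

section AlgebraicClosureOfSet
open Polynomial
variable {E : Type*} [Field E]

/-- The relative algebraic closure in `E` of the subfield generated by `S`. -/
def acl (S : Set E) : Subfield E := (algebraicClosure (Subfield.closure S) E).toSubfield

theorem mem_acl {S : Set E} {x : E} : x ∈ acl S ↔ IsAlgebraic (Subfield.closure S) x :=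
  mem_algebraicClosure_iff

theorem closure_le_acl (S : Set E) : Subfield.closure S ≤ acl S := fun x hx ↦
  mem_acl.2 (isAlgebraic_algebraMap (⟨x, hx⟩ : Subfield.closure S))

theorem subset_acl (S : Set E) : S ⊆ acl S := fun _ hx ↦
  closure_le_acl S (Subfield.subset_closure hx)

theorem isAlgebraic_adjoin_iff_mem_acl {A S : Set E} {x : E} :
    IsAlgebraic (Algebra.adjoin (Subfield.closure A) S) x ↔ x ∈ acl (A ∪ S) := by
  set k := Subfield.closure A
  have hkA {y : E} (hy : y ∈ k) : IsAlgebraic (Algebra.adjoin k S) y :=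
    isAlgebraic_algebraMap (⟨y, (Algebra.adjoin k S).algebraMap_mem ⟨y, hy⟩⟩ : Algebra.adjoin k S)
  constructor
  · intro h
    have hle (y : E) (hy : y ∈ Algebra.adjoin k S) : y ∈ Subfield.closure (A ∪ S) := by
      induction hy using Algebra.adjoin_induction with
      | mem y hy => exact Subfield.subset_closure (.inr hy)
      | algebraMap r => exact Subfield.closure_mono Set.subset_union_left r.2
      | add a b _ _ ha hb => exact add_mem ha hb
      | mul a b _ _ ha hb => exact mul_mem ha hb
    let f := (Algebra.adjoin k S).val.toRingHom.codRestrict (Subfield.closure (A ∪ S))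
      fun y ↦ hle y y.2
    have hf : Function.Injective f := fun a b hab ↦ Subtype.ext congr(($hab : E))
    exact mem_acl.2 <| h.ringHom_of_comp_eq f (RingHom.id E) hf rfl
  · intro h
    have hcl (y : E) (hy : y ∈ Subfield.closure (A ∪ S)) : IsAlgebraic (Algebra.adjoin k S) y := by
      induction hy using Subfield.closure_induction with
      | mem y hy =>
        obtain hy | hy := hy
        · exact hkA (Subfield.subset_closure hy)
        · exact isAlgebraic_algebraMap (⟨y, Algebra.subset_adjoin hy⟩ : Algebra.adjoin k S)
      | one => exact isAlgebraic_one
      | add a b _ _ ha hb => exact ha.add hb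
      | neg a _ ha => exact ha.neg
      | inv a _ ha => exact ha.inv
      | mul a b _ _ ha hb => exact ha.mul hb
    let f : Subfield.closure (A ∪ S) →+* Algebra.adjoin k (Subfield.closure (A ∪ S) : Set E) :=
      (Subfield.closure (A ∪ S)).subtype.codRestrict _ fun y ↦ Algebra.subset_adjoin y.2
    have hf : Function.Injective f := fun a b hab ↦ Subtype.ext congr(($hab : E))
    exact IsAlgebraic.adjoin_of_forall_isAlgebraic (s := (Subfield.closure (A ∪ S) : Set E))
      (fun y hy ↦ hcl y hy.1) ((mem_acl.1 h).ringHom_of_comp_eq f (RingHom.id E) hf rfl)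

theorem coe_acl_union_eq_closure (A S : Set E) :
    (acl (A ∪ S) : Set E) = (AlgebraicIndependent.matroid (Subfield.closure A) E).closure S := by
  ext x
  rw [AlgebraicIndependent.matroid_closure_eq, SetLike.mem_coe, SetLike.mem_coe,
    Subalgebra.mem_algebraicClosure, isAlgebraic_adjoin_iff_mem_acl]

/-- A derivation mapping `S` into the algebraic closure of `S` preserves this closure. -/
theorem deriv_mem_acl [CharZero E] {δ : E → E} (hadd : ∀ a b, δ (a + b) = δ a + δ b)
    (hmul : ∀ a b, δ (a * b) = a * δ b + δ a * b) {S : Set E} (hS : ∀ s ∈ S, δ s ∈ acl S)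
    {x : E} (hx : x ∈ acl S) : δ x ∈ acl S := by
  let D : Derivation ℤ E E := .mk' ((AddMonoidHom.mk' δ hadd).toIntLinearMap) fun a b ↦ by
    simp [hmul, mul_comm]
  have hD (x) : δ x = D x := rfl
  have hcl : ∀ y ∈ Subfield.closure S, δ y ∈ acl S := by
    intro y hy
    induction hy using Subfield.closure_induction with
    | mem y hy => exact hS y hy
    | one => simp [hD]
    | add a b _ _ ha hb => rw [hadd]; exact add_mem ha hb
    | neg a _ ha => rw [hD, map_neg]; exact neg_mem ha
    | inv a h ha =>
      rw [hD, D.leibniz_inv]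
      exact mul_mem (neg_mem (pow_mem (inv_mem (closure_le_acl S h)) 2)) ha
    | mul a b h h' ha hb =>
      rw [hmul]
      exact add_mem (mul_mem (closure_le_acl S h) hb) (mul_mem ha (closure_le_acl S h'))
  have hint := (mem_acl.1 hx).isIntegral
  set p := minpoly (Subfield.closure S) x
  have h0 : ∑ i ∈ Finset.range (p.natDegree + 1), (p.coeff i : E) * x ^ i = 0 := by
    have := minpoly.aeval (Subfield.closure S) x
    rwa [aeval_eq_sum_range] at this
  have h1 : aeval x (derivative p) ≠ 0 :=
    (minpoly.irreducible hint).separable.aeval_derivative_ne_zero (minpoly.aeval _ x)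
  have h2 : ∑ i ∈ Finset.range (p.natDegree + 1), D (p.coeff i : E) * x ^ i
      + aeval x (derivative p) * D x = 0 := by
    rw [← map_zero D, ← h0, map_sum]
    simp only [D.leibniz, D.leibniz_pow, Finset.sum_add_distrib, smul_eq_mul]
    rw [add_comm]
    congr 1
    · conv_lhs => rw [p.as_sum_range_C_mul_X_pow]
      simp only [map_sum, Finset.sum_mul, derivative_C_mul_X_pow]
      refine Finset.sum_congr rfl fun i _ ↦ ?_
      simpa [mul_assoc] using .inl rfl
    · exact Finset.sum_congr rfl fun _ _ ↦ mul_comm _ _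
  have h3 : D x = -(∑ i ∈ Finset.range (p.natDegree + 1), D (p.coeff i : E) * x ^ i)
      / aeval x (derivative p) := by
    rw [eq_div_iff h1]; linear_combination h2
  rw [hD, h3]
  refine div_mem (neg_mem (sum_mem fun i _ ↦ mul_mem (hcl _ (p.coeff i).2) (pow_mem hx i))) ?_
  rw [aeval_eq_sum_range]
  exact sum_mem fun i _ ↦ mul_mem (closure_le_acl S (SetLike.coe_mem _)) (pow_mem hx i)

/-- If `w` is transcendental over `Ω`, and `x` and `y` are algebraic over `Ω ⊇ N`, then `x` is
algebraic over `N` as soon as `x * w + y` is algebraic over `N` and `w`. -/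
theorem mem_acl_of_mul_add_mem_acl_insert {N Ω : Set E} (hN : N ⊆ acl Ω)
    {w x y : E} (hw : w ∉ acl Ω) (hx : x ∈ acl Ω) (hy : y ∈ acl Ω)
    (h : x * w + y ∈ acl (insert w N)) : x ∈ acl N := by
  set k := Subfield.closure N
  set L := algebraicClosure (Subfield.closure Ω) E
  have hkL : k ≤ L.toSubfield := Subfield.closure_le.2 hN
  have hwL : Transcendental L w := fun h ↦ hw (mem_acl.2 (h.restrictScalars _))
  rw [← Set.union_singleton, ← isAlgebraic_adjoin_iff_mem_acl] at h
  obtain ⟨p, hp0, hp⟩ := h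
  have hq (a : Algebra.adjoin k {w}) : ∃ q : k[X], aeval w q = (a : E) := by
    exact (SetLike.ext_iff.1 (Algebra.adjoin_singleton_eq_range_aeval k w) (a : E)).1 a.2
  choose q hq using hq
  let ι : k →+* L := Subfield.inclusion hkL
  let m := p.support.sup fun i ↦ (q (p.coeff i)).natDegree + i
  have hm {i : ℕ} (hi : i ∈ p.support) : (q (p.coeff i)).natDegree + i ≤ m :=
    Finset.le_sup (f := fun i ↦ (q (p.coeff i)).natDegree + i) hi
  let P : L[X] := ∑ i ∈ p.support,
    (q (p.coeff i)).map ι * (C (⟨x, hx⟩ : L) * X + C (⟨y, hy⟩ : L)) ^ i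
  have hP : P = 0 := by
    refine (transcendental_iff.1 hwL) P ?_
    rw [aeval_def, eval₂_eq_sum, sum_def] at hp
    rw [← hp, map_sum]
    refine Finset.sum_congr rfl fun i _ ↦ ?_
    have : aeval w ((q (p.coeff i)).map ι) = aeval w (q (p.coeff i)) := by
      rw [aeval_def, eval₂_map]; rfl
    rw [map_mul, this, hq]
    simp
  let r : k[X] := ∑ i ∈ p.support, C ((q (p.coeff i)).coeff (m - i)) * X ^ i
  have hr : aeval x r = 0 := by
    have h0 : ((P.coeff m : L) : E) = 0 := by rw [hP]; simp
    rw [← h0]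
    simp only [P, r, finsetSum_coeff, map_sum, AddSubmonoidClass.coe_finsetSum]
    refine Finset.sum_congr rfl fun i hi ↦ ?_
    have hi' : m - i + i = m := by have := hm hi; omega
    have hlin : (C (⟨x, hx⟩ : L) * X + C (⟨y, hy⟩ : L)).natDegree ≤ 1 := natDegree_linear_le
    have := coeff_mul_add_eq_of_natDegree_le (f := (q (p.coeff i)).map ι) (df := m - i) (dg := i)
      (natDegree_map_le.trans (by have := hm hi; omega))
      ((natDegree_pow_le_of_le i hlin).trans_eq (mul_one i))
    rw [hi'] at this
    rw [this]
    have h1 := coeff_pow_of_natDegree_le (m := i) hlin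
    rw [mul_one] at h1
    rw [h1]
    simpa using .inl rfl
  obtain ⟨i, hi, him⟩ := Finset.exists_mem_eq_sup p.support (support_nonempty.2 hp0)
    fun i ↦ (q (p.coeff i)).natDegree + i
  refine mem_acl.2 ⟨r, fun hr0 ↦ ?_, hr⟩
  have hci : r.coeff i = (q (p.coeff i)).coeff (m - i) := by
    simp only [r, finsetSum_coeff, coeff_C_mul_X_pow]
    rw [Finset.sum_eq_single_of_mem i hi fun j _ hj ↦ if_neg hj.symm, if_pos rfl]
  have hmi : m - i = (q (p.coeff i)).natDegree := by omega
  rw [hr0, hmi, coeff_zero, eq_comm, ← leadingCoeff, leadingCoeff_eq_zero] at hci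
  have := hq (p.coeff i)
  rw [hci, map_zero, eq_comm, ZeroMemClass.coe_eq_zero] at this
  exact mem_support_iff.1 hi this

end AlgebraicClosureOfSet

open scoped Matroid

section AlgebraicMatroid
variable {E : Type*} [Field E] {A S : Set E}

variable (E) in
/-- The matroid of algebraic independence over the prime field of `E`. -/
noncomputable abbrev algMatroid : Matroid E :=
  AlgebraicIndependent.matroid (Subfield.closure (∅ : Set E)) E

theorem algMatroid_closure (S : Set E) : (algMatroid E).closure S = acl S := by
  rw [← coe_acl_union_eq_closure, Set.empty_union]

theorem mem_algMatroid_closure {x : E} : x ∈ (algMatroid E).closure S ↔ x ∈ acl S := by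
  rw [algMatroid_closure, SetLike.mem_coe]

theorem algMatroid_contract_indep_iff {I : Set E} :
    ((algMatroid E) ／ A).Indep I ↔ AlgebraicIndepOn (Subfield.closure A) id I := by
  rw [Matroid.contract_indep_iff_forall_notMem_closure (Set.subset_univ I),
    ← AlgebraicIndependent.matroid_indep_iff, Matroid.indep_iff_forall_notMem_closure_sdiff]
  simp only [algMatroid_closure, ← coe_acl_union_eq_closure A, SetLike.mem_coe]

theorem trdeg_adjoin_eq_iff_eRk_eq {k : Subfield E} (hk : k = Subfield.closure A) {m : ℕ} :
    Trdeg k (IntermediateField.adjoin k S) = m ↔ ((algMatroid E) ／ A).eRk S = m := by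
  subst hk
  set k := Subfield.closure A
  set L := IntermediateField.adjoin k S
  obtain ⟨I, hI⟩ := (AlgebraicIndependent.matroid k E).exists_isBasis S (Set.subset_univ S)
  have hScl : S ⊆ acl (A ∪ I) := by
    rw [coe_acl_union_eq_closure]; exact hI.subset_closure
  have hLcl (y : E) (hy : y ∈ L) : y ∈ acl (A ∪ I) := by
    induction hy using IntermediateField.adjoin_induction with
    | mem y hy => exact hScl hy
    | algebraMap y => exact closure_le_acl _ (Subfield.closure_mono Set.subset_union_left y.2)
    | add a b _ _ ha hb => exact add_mem ha hb
    | inv a _ ha => exact inv_mem ha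
    | mul a b _ _ ha hb => exact mul_mem ha hb
  have hIL : I ⊆ L := hI.subset.trans (IntermediateField.subset_adjoin k S)
  have hbase : IsTranscendenceBasis k (Set.inclusion hIL : I → L) := by
    refine ⟨AlgebraicIndependent.of_comp L.val (by exact hI.indep), fun J hJ hIJ ↦
      hIJ.antisymm fun x hx ↦ ?_⟩
    by_contra hxI
    have hJ' : (AlgebraicIndependent.matroid k E).Indep ((↑) '' J) := by
      rw [AlgebraicIndependent.matroid_indep_iff]
      exact (algebraicIndependent_image L.val.injective.injOn).1 (hJ.map' L.val.injective)
    refine (Matroid.indep_iff_forall_notMem_closure_sdiff (Set.subset_univ _)).1 hJ' ⟨x, hx, rfl⟩ ?_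
    have hx' := hLcl x x.2
    rw [← SetLike.mem_coe, coe_acl_union_eq_closure] at hx'
    refine Matroid.closure_subset_closure _ (fun y hy ↦ ?_) hx'
    refine ⟨⟨⟨y, hIL hy⟩, hIJ ⟨⟨y, hy⟩, rfl⟩, rfl⟩, fun hyx ↦ hxI ?_⟩
    exact ⟨⟨y, hy⟩, Subtype.ext hyx⟩
  have hcard : Trdeg k L = Cardinal.mk I := hbase.cardinalMk_eq_trdeg.symm
  have hrk : ((algMatroid E) ／ A).eRk S = I.encard := by
    rw [← (algMatroid_contract_indep_iff.2 hI.indep).eRk_eq_encard]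
    refine (Matroid.eRk_contract_le_of_subset_closure ?_).antisymm (Matroid.eRk_mono _ hI.subset)
    rwa [algMatroid_closure]
  rw [hcard, hrk, Set.encard, ENat.card, Cardinal.toENat_eq_natCast]

end AlgebraicMatroid

section IndepOver
variable {E : Type*} [Field E] {ι κ : Type*} {A B S T : Set E} {w : ι → E}

theorem acl_le_acl (h : S ⊆ acl T) : acl S ≤ acl T := by
  intro x
  rw [← mem_algMatroid_closure, ← mem_algMatroid_closure]
  rw [← algMatroid_closure] at h
  exact fun hx ↦ Matroid.closure_subset_closure_of_subset_closure h hx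

theorem acl_mono (h : S ⊆ T) : acl S ≤ acl T := acl_le_acl (h.trans (subset_acl T))

/-- No member of the family `w` is algebraic over the field generated by `A` and the other
members. -/
def IndepOver (A : Set E) (w : ι → E) : Prop := ∀ i, w i ∉ acl (A ∪ w '' {i}ᶜ)

theorem AlgebraicIndependent.indepOver (h : AlgebraicIndependent (Subfield.closure A) w) :
    IndepOver A w := fun i hi ↦
  h.transcendental_adjoin (s := {i}ᶜ) (i := i) (by simp) (isAlgebraic_adjoin_iff_mem_acl.2 hi)

theorem IndepOver.comp (h : IndepOver A w) {f : κ → ι} (hf : Function.Injective f)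
    (hB : B ⊆ acl (A ∪ w '' (Set.range f)ᶜ)) : IndepOver B (w ∘ f) := by
  refine fun i hi ↦ h (f i) (acl_le_acl (Set.union_subset (hB.trans ?_) ?_) hi)
  · refine acl_mono (Set.union_subset_union_right _ (Set.image_mono ?_))
    exact Set.compl_subset_compl.2 (by simp)
  · rintro _ ⟨j, hj, rfl⟩
    exact subset_acl _ (.inr ⟨f j, fun hji ↦ hj (hf hji), rfl⟩)

theorem IndepOver.mono (h : IndepOver A w) (hB : B ⊆ acl A) : IndepOver B w :=
  h.comp Function.injective_id (hB.trans (acl_mono Set.subset_union_left))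

theorem IndepOver.contract_indep_range (h : IndepOver A w) :
    (algMatroid E ／ A).Indep (Set.range w) := by
  rw [Matroid.contract_indep_iff_forall_notMem_closure (Set.subset_univ _)]
  rintro _ ⟨i, rfl⟩ hi
  refine h i (acl_mono (Set.union_subset_union_right _ ?_) (mem_algMatroid_closure.1 hi))
  rintro _ ⟨⟨j, rfl⟩, hj⟩
  exact ⟨j, fun hji ↦ hj (congrArg w hji), rfl⟩

theorem eRk_contract_le_of_subset_acl (h : S ⊆ acl (A ∪ T)) :
    (algMatroid E ／ A).eRk S ≤ (algMatroid E ／ A).eRk T :=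
  Matroid.eRk_contract_le_of_subset_closure (by rwa [algMatroid_closure])

end IndepOver

section Leibniz

theorem iterate_leibniz {R : Type*} [CommRing R] {δ : R → R} (hadd : ∀ a b, δ (a + b) = δ a + δ b)
    (hmul : ∀ a b, δ (a * b) = a * δ b + δ a * b) (a b : R) (k : ℕ) :
    δ^[k] (a * b) = ∑ j ∈ Finset.range (k + 1), (k.choose j : R) * δ^[j] a * δ^[k - j] b := by
  let D : Derivation ℤ R R := .mk' ((AddMonoidHom.mk' δ hadd).toIntLinearMap) fun a b ↦ by
    simp [hmul, mul_comm]
  have hD : δ = D := rfl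
  rw [← Finset.Nat.sum_antidiagonal_eq_sum_range_succ
    (fun i j ↦ (k.choose i : R) * δ^[i] a * δ^[j] b)]
  induction k with
  | zero => simp
  | succ k ih =>
    have h2 := Finset.sum_antidiagonal_choose_succ_mul (R := R) (fun i j ↦ δ^[i] a * δ^[j] b) k
    simp only [mul_assoc] at ih ⊢
    rw [Function.iterate_succ_apply', ih, h2, hD, map_sum, ← Finset.sum_add_distrib]
    refine Finset.sum_congr rfl fun p hp ↦ ?_
    simp only [D.leibniz, Function.iterate_succ_apply', smul_eq_mul, D.map_natCast]
    rw [Nat.choose_symm_of_eq_add (Finset.HasAntidiagonal.mem_antidiagonal.1 hp).symm]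
    ring

theorem iterate_map_sum {R ι : Type*} [CommRing R] {δ : R → R}
    (hadd : ∀ a b, δ (a + b) = δ a + δ b) (s : Finset ι) (f : ι → R) (k : ℕ) :
    δ^[k] (-∑ i ∈ s, f i) = -∑ i ∈ s, δ^[k] (f i) := by
  let D : R →+ R := AddMonoidHom.mk' δ hadd
  have hD : δ = D := rfl
  induction k with
  | zero => simp
  | succ k ih => simp only [Function.iterate_succ_apply', ih]; simp [hD]

end Leibniz

section DifferentialElimination
variable {E ι : Type*}

/-- All iterated derivatives of the members of the family `a`. -/
def derivs (δ : E → E) (a : ι → E) : Set E := {x | ∃ i k, δ^[k] (a i) = x}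

/-- The iterated derivatives of order less than `s` of the members of the family `a`. -/
def derivsLT (δ : E → E) (a : ι → E) (s : ℕ) : Set E := {x | ∃ i, ∃ k < s, δ^[k] (a i) = x}

theorem derivsLT_subset_derivs (δ : E → E) (a : ι → E) (s : ℕ) : derivsLT δ a s ⊆ derivs δ a :=
  fun _ ⟨i, k, _, h⟩ ↦ ⟨i, k, h⟩

theorem derivs_eq_range (δ : E → E) (a : ι → E) :
    derivs δ a = Set.range fun p : ι × ℕ ↦ δ^[p.2] (a p.1) := by
  ext; simp [derivs]

variable [Field E] {δ : E → E} {A : Set E} {v ξ : ι → E} {z : E}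

theorem eRk_derivsLT_contract_derivs
    (hv : IndepOver (A ∪ derivs δ ξ) fun p : ι × ℕ ↦ δ^[p.2] (v p.1)) (s : ℕ) :
    (algMatroid E ／ (A ∪ derivs δ v)).eRk (derivsLT δ ξ s) =
      (algMatroid E ／ A).eRk (derivsLT δ ξ s) := by
  refine Matroid.eRk_contract_union_eq_of_indep ?_
  rw [derivs_eq_range]
  exact (hv.mono ((Set.union_subset_union_right _
    (derivsLT_subset_derivs δ ξ s)).trans (subset_acl _))).contract_indep_range

variable [Fintype ι] (hadd : ∀ a b, δ (a + b) = δ a + δ b)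
  (hmul : ∀ a b, δ (a * b) = a * δ b + δ a * b)

include hadd hmul

theorem iterate_neg_sum_mul (hz : z = -∑ ρ, v ρ * ξ ρ) (k : ℕ) :
    δ^[k] z = -∑ p ∈ Finset.univ ×ˢ Finset.range (k + 1),
      (k.choose p.2 : E) * δ^[p.2] (v p.1) * δ^[k - p.2] (ξ p.1) := by
  simp only [hz, iterate_map_sum hadd, iterate_leibniz hadd hmul, Finset.sum_product]

theorem iterate_mem_acl (hz : z = -∑ ρ, v ρ * ξ ρ) {k s : ℕ} (hk : k < s) :
    δ^[k] z ∈ acl (A ∪ derivs δ v ∪ derivsLT δ ξ s) := by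
  rw [iterate_neg_sum_mul hadd hmul hz]
  refine neg_mem (sum_mem fun p _ ↦ mul_mem (mul_mem (natCast_mem _ _) ?_) ?_)
  · exact subset_acl _ (.inl (.inr ⟨p.1, p.2, rfl⟩))
  · exact subset_acl _ (.inr ⟨p.1, k - p.2, by omega, rfl⟩)

theorem iterate_add_mul_mem_acl (hz : z = -∑ ρ, v ρ * ξ ρ) (ρ : ι) (i k : ℕ) :
    δ^[k] z + (k.choose i : E) * δ^[i] (v ρ) * δ^[k - i] (ξ ρ) ∈
      acl (A ∪ derivs δ ξ ∪ (fun p : ι × ℕ ↦ δ^[p.2] (v p.1)) '' {(ρ, i)}ᶜ) := by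
  classical
  rw [iterate_neg_sum_mul hadd hmul hz]
  set f : ι × ℕ → E := fun p ↦ (k.choose p.2 : E) * δ^[p.2] (v p.1) * δ^[k - p.2] (ξ p.1) with hf
  set T : Finset (ι × ℕ) := Finset.univ ×ˢ Finset.range (k + 1)
  have h : -∑ p ∈ T, f p + f (ρ, i) = -∑ p ∈ T.erase (ρ, i), f p := by
    by_cases hi : (ρ, i) ∈ T
    · rw [← Finset.add_sum_erase T f hi]; ring
    · have : k < i := by simpa [T] using hi
      simp [Finset.erase_eq_of_notMem hi, hf, Nat.choose_eq_zero_of_lt this]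
  change -∑ p ∈ T, f p + f (ρ, i) ∈ _
  rw [h]
  refine neg_mem (sum_mem fun p hp ↦ mul_mem (mul_mem (natCast_mem _ _) ?_) ?_)
  · exact subset_acl _ (.inr ⟨p, Finset.ne_of_mem_erase hp, rfl⟩)
  · exact subset_acl _ (.inl (.inr ⟨p.1, k - p.2, rfl⟩))

variable [CharZero E]

theorem iterate_mem_acl_of_iterate_mem_acl
    (hv : IndepOver (A ∪ derivs δ ξ) fun p : ι × ℕ ↦ δ^[p.2] (v p.1))
    (hz : z = -∑ ρ, v ρ * ξ ρ) {s i : ℕ}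
    (h : δ^[s + i] z ∈ acl (A ∪ derivs δ v ∪ derivsLT δ ξ s ∪ (fun k ↦ δ^[k] z) '' Set.Iio (s + i)))
    (ρ : ι) :
    δ^[s] (ξ ρ) ∈ acl (A ∪ derivs δ v ∪ derivsLT δ ξ s ∪ (fun k ↦ δ^[k] z) '' Set.Iio (s + i)) := by
  set C := A ∪ derivs δ v ∪ derivsLT δ ξ s ∪ (fun k ↦ δ^[k] z) '' Set.Iio (s + i)
  set W := (fun p : ι × ℕ ↦ δ^[p.2] (v p.1)) '' {(ρ, i)}ᶜ
  set w := δ^[i] (v ρ)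
  set y : ℕ → E := fun k ↦ δ^[k] z + (k.choose i : E) * w * δ^[k - i] (ξ ρ) with hy
  set N := A ∪ derivsLT δ ξ s ∪ W ∪ y '' Set.Iio (s + i)
  have hzy (k : ℕ) : δ^[k] z = y k - (k.choose i : E) * w * δ^[k - i] (ξ ρ) := by simp [hy]
  have hyΩ (k : ℕ) : y k ∈ acl (A ∪ derivs δ ξ ∪ W) :=
    iterate_add_mul_mem_acl hadd hmul hz ρ i k
  have hW : W ⊆ derivs δ v := by rintro _ ⟨p, -, rfl⟩; exact ⟨p.1, p.2, rfl⟩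
  have hcorr {k : ℕ} (hk : k < s + i) {D : Set E} (hD : derivsLT δ ξ s ⊆ D) (hw : w ∈ D) :
      (k.choose i : E) * w * δ^[k - i] (ξ ρ) ∈ acl D := by
    obtain hik | hik := le_or_gt i k
    · exact mul_mem (mul_mem (natCast_mem _ _) (subset_acl _ hw))
        (subset_acl _ (hD ⟨ρ, k - i, by omega, rfl⟩))
    · simp [Nat.choose_eq_zero_of_lt hik]
  have hNC : N ⊆ acl C := by
    rintro x (((hx | hx) | hx) | ⟨k, hk, rfl⟩)
    · exact subset_acl _ (.inl (.inl (.inl hx)))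
    · exact subset_acl _ (.inl (.inr hx))
    · exact subset_acl _ (.inl (.inl (.inr (hW hx))))
    · exact add_mem (subset_acl _ (.inr ⟨k, hk, rfl⟩))
        (hcorr hk (fun x hx ↦ .inl (.inr hx)) (.inl (.inl (.inr ⟨ρ, i, rfl⟩))))
  have hCN : C ⊆ acl (insert w N) := by
    rintro x (((hx | hx) | hx) | ⟨k, hk, rfl⟩)
    · exact subset_acl _ (.inr (.inl (.inl (.inl hx))))
    · obtain ⟨ρ', k, rfl⟩ := hx
      by_cases heq : (ρ', k) = (ρ, i)
      · obtain ⟨rfl, rfl⟩ := Prod.mk.injEq .. ▸ heq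
        exact subset_acl _ (Set.mem_insert _ _)
      · exact subset_acl _ (.inr (.inl (.inr ⟨(ρ', k), heq, rfl⟩)))
    · exact subset_acl _ (.inr (.inl (.inl (.inr hx))))
    · simp only [hzy k]
      exact sub_mem (subset_acl _ (.inr (.inr ⟨k, hk, rfl⟩)))
        (hcorr hk (fun x hx ↦ .inr (.inl (.inl (.inr hx)))) (Set.mem_insert _ _))
  have hNΩ : N ⊆ acl (A ∪ derivs δ ξ ∪ W) := by
    rintro x (((hx | hx) | hx) | ⟨k, hk, rfl⟩)
    · exact subset_acl _ (.inl (.inl hx))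
    · exact subset_acl _ (.inl (.inr (derivsLT_subset_derivs _ _ _ hx)))
    · exact subset_acl _ (.inr hx)
    · exact hyΩ k
  have hchoose : ((s + i).choose i : E) ≠ 0 :=
    Nat.cast_ne_zero.2 (Nat.choose_pos (Nat.le_add_left i s)).ne'
  have hmem : -((s + i).choose i : E) * δ^[s] (ξ ρ) ∈ acl N := by
    refine mem_acl_of_mul_add_mem_acl_insert hNΩ (w := w) (y := y (s + i)) (hv (ρ, i)) ?_ (hyΩ _) ?_
    · exact mul_mem (neg_mem (natCast_mem _ _)) (subset_acl _ (.inl (.inr ⟨ρ, s, rfl⟩)))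
    · have := acl_le_acl hCN h
      rw [hzy, Nat.add_sub_cancel] at this
      convert this using 1
      ring
  have := mul_mem (inv_mem (neg_mem (natCast_mem (acl N) ((s + i).choose i)))) hmem
  rw [inv_mul_cancel_left₀ (neg_ne_zero.2 hchoose)] at this
  exact acl_le_acl hNC this

theorem derivs_subset_acl_of_iterate_mem_acl (hA : ∀ a ∈ A, δ a ∈ acl A)
    (hv : IndepOver (A ∪ derivs δ ξ) fun p : ι × ℕ ↦ δ^[p.2] (v p.1))
    (hz : z = -∑ ρ, v ρ * ξ ρ) {s i : ℕ}
    (h : δ^[s + i] z ∈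
      acl (A ∪ derivs δ v ∪ derivsLT δ ξ s ∪ (fun k ↦ δ^[k] z) '' Set.Iio (s + i))) :
    derivs δ ξ ⊆ acl (A ∪ derivs δ v ∪ derivsLT δ ξ s ∪ (fun k ↦ δ^[k] z) '' Set.Iio (s + i)) := by
  have hs := iterate_mem_acl_of_iterate_mem_acl hadd hmul hv hz h
  set C := A ∪ derivs δ v ∪ derivsLT δ ξ s ∪ (fun k ↦ δ^[k] z) '' Set.Iio (s + i)
  have hlt {ρ : ι} {k : ℕ} (hk : k < s) : δ^[k] (ξ ρ) ∈ acl C :=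
    subset_acl _ (.inl (.inr ⟨ρ, k, hk, rfl⟩))
  have hC : ∀ x ∈ C, δ x ∈ acl C := by
    rintro x (((hx | ⟨ρ, k, rfl⟩) | ⟨ρ, k, hk, rfl⟩) | ⟨k, hk, rfl⟩)
    · exact acl_mono (fun y hy ↦ .inl (.inl (.inl hy))) (hA x hx)
    · rw [← Function.iterate_succ_apply' δ]
      exact subset_acl _ (.inl (.inl (.inr ⟨ρ, k + 1, rfl⟩)))
    · rw [← Function.iterate_succ_apply' δ]
      obtain hk' | rfl := Nat.lt_or_eq_of_le (Nat.succ_le_of_lt hk)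
      exacts [hlt hk', hs ρ]
    · simp only [← Function.iterate_succ_apply' δ]
      obtain hk' | hk' := Nat.lt_or_eq_of_le (Nat.succ_le_of_lt hk)
      · exact subset_acl _ (.inr ⟨k + 1, hk', rfl⟩)
      · rwa [hk']
  rintro _ ⟨ρ, k, rfl⟩
  obtain hk | hk := lt_or_ge k s
  · exact hlt hk
  · induction k, hk using Nat.le_induction with
    | base => exact hs ρ
    | succ k _ ih =>
      rw [Function.iterate_succ_apply']
      exact deriv_mem_acl hadd hmul hC ih

/-- Adjoining a generic hyperplane section lowers the differential dimension by one and keeps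
the order. -/
theorem eRk_derivsLT_contract_generic (hA : ∀ a ∈ A, δ a ∈ acl A)
    (hv : IndepOver (A ∪ derivs δ ξ) fun p : ι × ℕ ↦ δ^[p.2] (v p.1))
    (hz : z = -∑ ρ, v ρ * ξ ρ) {d h T : ℕ}
    (hdim : ∀ s ≥ T, (algMatroid E ／ A).eRk (derivsLT δ ξ s) = ((d + 1) * s + h : ℕ)) :
    ∀ s ≥ T, (algMatroid E ／ (A ∪ derivs δ v ∪ Set.range fun k ↦ δ^[k] z)).eRk (derivsLT δ ξ s) =
      (d * s + h : ℕ) := by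
  set M := algMatroid E
  set V := derivs δ v
  set Z : ℕ → E := fun k ↦ δ^[k] z
  have hdim' : ∀ s ≥ T, (M ／ (A ∪ V)).eRk (derivsLT δ ξ s) = ((d + 1) * s + h : ℕ) :=
    fun s hs ↦ (eRk_derivsLT_contract_derivs hv s).trans (hdim s hs)
  have hnot (s i : ℕ) : Z (s + i) ∉ acl (A ∪ V ∪ derivsLT δ ξ s ∪ Z '' Set.Iio (s + i)) := by
    intro hmem
    have hsub := derivs_subset_acl_of_iterate_mem_acl hadd hmul hA hv hz hmem
    have hle (t : ℕ) : (M ／ (A ∪ V)).eRk (derivsLT δ ξ t) ≤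
        (derivsLT δ ξ s ∪ Z '' Set.Iio (s + i)).encard := by
      refine (eRk_contract_le_of_subset_acl ?_).trans (Matroid.eRk_le_encard _ _)
      rw [← Set.union_assoc]
      exact (derivsLT_subset_derivs δ ξ t).trans hsub
    have hfin : (derivsLT δ ξ s ∪ Z '' Set.Iio (s + i)).Finite := by
      refine .union (((Set.finite_univ (α := ι)).prod (Set.finite_Iio s)).image
        (fun p ↦ δ^[p.2] (ξ p.1)) |>.subset ?_) ((Set.finite_Iio _).image Z)
      rintro _ ⟨ρ, k, hk, rfl⟩
      exact ⟨(ρ, k), ⟨trivial, hk⟩, rfl⟩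
    have := hle (max T (hfin.toFinset.card + 1))
    rw [hdim' _ (le_max_left _ _), hfin.encard_eq_coe_toFinset_card, Nat.cast_le] at this
    have := le_max_right T (hfin.toFinset.card + 1)
    nlinarith
  have hZ (m : ℕ) : (M ／ (A ∪ V)).eRk (Z '' Set.Iio m) = m := by
    refine Matroid.eRk_contract_image_Iio_of_forall_notMem_closure (Set.subset_univ _)
      (fun k hk ↦ hnot 0 k ?_) m
    rw [mem_algMatroid_closure] at hk
    rw [Nat.zero_add]
    exact acl_mono (Set.union_subset_union_left _ Set.subset_union_left) hk
  intro s hs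
  have hsplit : A ∪ V ∪ Set.range Z =
      A ∪ V ∪ Z '' Set.Iio s ∪ Set.range fun i ↦ Z (s + i) := by
    rw [Set.union_assoc (A ∪ V)]
    congr 1
    refine (Set.union_subset (Set.image_subset_range Z _) ?_).antisymm' ?_
    · rintro _ ⟨i, rfl⟩
      exact ⟨s + i, rfl⟩
    · rintro _ ⟨k, rfl⟩
      obtain hk | hk := lt_or_ge k s
      · exact .inl ⟨k, hk, rfl⟩
      · exact .inr ⟨k - s, by simp only [Nat.add_sub_cancel' hk]⟩
  have htail : (M ／ (A ∪ V ∪ Set.range Z)).eRk (derivsLT δ ξ s) =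
      (M ／ (A ∪ V ∪ Z '' Set.Iio s)).eRk (derivsLT δ ξ s) := by
    rw [hsplit]
    refine Matroid.eRk_contract_union_eq_of_indep ?_
    refine Matroid.contract_indep_range_of_forall_notMem_closure (Set.subset_univ _)
      fun k hk ↦ hnot s k ?_
    refine acl_mono (Set.union_subset ?_ ?_) (mem_algMatroid_closure.1 hk)
    · rw [Set.union_right_comm]
      refine Set.union_subset_union_right _ (Set.image_mono (Set.Iio_subset_Iio ?_))
      exact Nat.le_add_right s k
    · rintro _ ⟨i, hi, rfl⟩
      exact .inr ⟨s + i, Nat.add_lt_add_left hi s, rfl⟩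
  have hadd' := Matroid.eRk_contract_union M (A ∪ V) (Z '' Set.Iio s) (derivsLT δ ξ s)
  have hunion : (M ／ (A ∪ V)).eRk (Z '' Set.Iio s ∪ derivsLT δ ξ s) =
      (M ／ (A ∪ V)).eRk (derivsLT δ ξ s) := by
    refine (eRk_contract_le_of_subset_acl (Set.union_subset ?_ ?_)).antisymm
      (Matroid.eRk_mono _ Set.subset_union_right)
    · rintro _ ⟨k, hk, rfl⟩
      exact iterate_mem_acl hadd hmul hz hk
    · exact Set.subset_union_right.trans (subset_acl _)
  rw [hunion, hdim' s hs, hZ s, ← htail,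
    show (d + 1) * s + h = s + (d * s + h) by ring, Nat.cast_add] at hadd'
  exact (ENat.add_right_injective_of_ne_top (ENat.natCast_ne_top s) hadd').symm

theorem eRk_range_iterate_of_dim_zero (hA : ∀ a ∈ A, δ a ∈ acl A)
    (hv : IndepOver (A ∪ derivs δ ξ) fun p : ι × ℕ ↦ δ^[p.2] (v p.1))
    (hz : z = -∑ ρ, v ρ * ξ ρ) {h T : ℕ}
    (hdim : ∀ s ≥ T, (algMatroid E ／ A).eRk (derivsLT δ ξ s) = h) :
    (algMatroid E ／ (A ∪ derivs δ v)).eRk (Set.range fun k ↦ δ^[k] z) = h := by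
  set M := algMatroid E
  set V := derivs δ v
  set Z : ℕ → E := fun k ↦ δ^[k] z
  have hle {m s : ℕ} (hs : m ≤ s) : Z '' Set.Iio m ⊆ acl (A ∪ V ∪ derivsLT δ ξ s) := by
    rintro _ ⟨k, hk, rfl⟩
    exact iterate_mem_acl hadd hmul hz (lt_of_lt_of_le hk hs)
  have hrk (m : ℕ) : (M ／ (A ∪ V)).eRk (Z '' Set.Iio m) ≤ h := by
    rw [← hdim (max m T) (le_max_right _ _), ← eRk_derivsLT_contract_derivs hv]
    exact eRk_contract_le_of_subset_acl (hle (le_max_left _ _))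
  obtain ⟨k, hk⟩ : ∃ k, Z k ∈ acl (A ∪ V ∪ Z '' Set.Iio k) := by
    by_contra! hnot
    have := hrk (h + 1)
    rw [Matroid.eRk_contract_image_Iio_of_forall_notMem_closure (Set.subset_univ _)
      (fun k hk ↦ hnot k (mem_algMatroid_closure.1 hk)), Nat.cast_le] at this
    omega
  have h0 : derivsLT δ ξ 0 = ∅ := by ext; simp [derivsLT]
  have hsub : derivs δ ξ ⊆ acl (A ∪ V ∪ Z '' Set.Iio k) := by
    have := derivs_subset_acl_of_iterate_mem_acl (s := 0) (i := k) hadd hmul hA hv hz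
    rw [h0, Set.union_empty, Nat.zero_add] at this
    exact this hk
  have hZk : (M ／ (A ∪ V)).eRk (Z '' Set.Iio k) = h := by
    refine (hrk k).antisymm ?_
    rw [← hdim T le_rfl, ← eRk_derivsLT_contract_derivs hv]
    exact eRk_contract_le_of_subset_acl ((derivsLT_subset_derivs _ _ _).trans hsub)
  rw [← hZk]
  refine (eRk_contract_le_of_subset_acl ?_).antisymm
    (Matroid.eRk_mono _ (Set.image_subset_range _ _))
  rintro _ ⟨m, rfl⟩
  refine acl_le_acl (Set.union_subset (Set.subset_union_left.trans (subset_acl _))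
    ((derivsLT_subset_derivs _ _ _).trans hsub)) (iterate_mem_acl hadd hmul hz m.lt_succ_self)

theorem eRk_range_iterate_of_generic {d n h : ℕ} {ξ : Fin n → E} {A : Set E} {T : ℕ}
    (hA : ∀ a ∈ A, δ a ∈ acl A)
    (hdim : ∀ s ≥ T, (algMatroid E ／ A).eRk (derivsLT δ ξ s) = (d * s + h : ℕ))
    {u : Fin (d + 1) → Fin n → E}
    (hu : IndepOver (A ∪ derivs δ ξ)
      fun p : (Fin (d + 1) × Fin n) × ℕ ↦ δ^[p.2] (u p.1.1 p.1.2))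
    {ζ : Fin (d + 1) → E} (hζ : ∀ σ, ζ σ = -∑ ρ, u σ ρ * ξ ρ) :
    (algMatroid E ／ (A ∪ derivs δ (fun p : Fin (d + 1) × Fin n ↦ u p.1 p.2) ∪
      derivs δ fun σ : Fin d ↦ ζ σ.succ)).eRk (Set.range fun k ↦ δ^[k] (ζ 0)) = h := by
  induction d generalizing A with
  | zero =>
    have hv : IndepOver (A ∪ derivs δ ξ) fun p : Fin n × ℕ ↦ δ^[p.2] (u 0 p.1) :=
      hu.comp (f := fun p : Fin n × ℕ ↦ ((0, p.1), p.2)) (fun p q hpq ↦ by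
        simpa [Prod.ext_iff] using hpq) (Set.subset_union_left.trans (subset_acl _))
    have := eRk_range_iterate_of_dim_zero hadd hmul hA hv (hζ 0) (by simpa using hdim)
    convert this using 3
    ext; simp [derivs]
  | succ d ih =>
    have hv : IndepOver (A ∪ derivs δ ξ) fun p : Fin n × ℕ ↦ δ^[p.2] (u (Fin.last _) p.1) :=
      hu.comp (f := fun p : Fin n × ℕ ↦ ((Fin.last _, p.1), p.2)) (fun p q hpq ↦ by
        simpa [Prod.ext_iff] using hpq) (Set.subset_union_left.trans (subset_acl _))
    have hdim' := eRk_derivsLT_contract_generic hadd hmul hA hv (hζ _) hdim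
    set A' := A ∪ derivs δ (u (Fin.last _)) ∪ Set.range fun k ↦ δ^[k] (ζ (Fin.last _)) with hA'
    have hδA' : ∀ a ∈ A', δ a ∈ acl A' := by
      rintro a ((ha | ⟨ρ, k, rfl⟩) | ⟨k, rfl⟩)
      · exact acl_mono (fun x hx ↦ .inl (.inl hx)) (hA a ha)
      · rw [← Function.iterate_succ_apply' δ]
        exact subset_acl _ (.inl (.inr ⟨ρ, k + 1, rfl⟩))
      · simp only [← Function.iterate_succ_apply' δ]
        exact subset_acl _ (.inr ⟨k + 1, rfl⟩)
    have hu' : IndepOver (A' ∪ derivs δ ξ)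
        fun p : (Fin (d + 1) × Fin n) × ℕ ↦ δ^[p.2] (u p.1.1.castSucc p.1.2) := by
      refine hu.comp (f := fun p : (Fin (d + 1) × Fin n) × ℕ ↦ ((p.1.1.castSucc, p.1.2), p.2))
        (fun p q hpq ↦ by simpa [Prod.ext_iff] using hpq) ?_
      have hsub : A ∪ derivs δ (u (Fin.last _)) ∪ derivs δ ξ ⊆
          acl (A ∪ derivs δ ξ ∪ (fun p : (Fin (d + 2) × Fin n) × ℕ ↦ δ^[p.2] (u p.1.1 p.1.2)) ''
            (Set.range fun p : (Fin (d + 1) × Fin n) × ℕ ↦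
              ((p.1.1.castSucc, p.1.2), p.2))ᶜ) := by
        rintro x ((hx | ⟨ρ, k, rfl⟩) | hx)
        · exact subset_acl _ (.inl (.inl hx))
        · refine subset_acl _ (.inr ⟨((Fin.last _, ρ), k), ?_, rfl⟩)
          rintro ⟨p, hp⟩
          simp [Prod.ext_iff, (Fin.castSucc_lt_last _).ne] at hp
        · exact subset_acl _ (.inl (.inr hx))
      rintro x ((hx | ⟨k, rfl⟩) | hx)
      · exact hsub (.inl hx)
      · refine acl_le_acl ?_ (iterate_mem_acl (A := A) (z := ζ (Fin.last _))
          (v := u (Fin.last _)) (ξ := ξ) hadd hmul (hζ _) k.lt_succ_self)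
        exact (Set.union_subset_union_right _ (derivsLT_subset_derivs _ _ _)).trans hsub
      · exact hsub (.inr hx)
    have := ih (u := fun σ ↦ u σ.castSucc) (ζ := fun σ ↦ ζ σ.castSucc) hδA' hdim' hu'
      fun σ ↦ hζ _
    have hsplitu : derivs δ (fun p : Fin (d + 2) × Fin n ↦ u p.1 p.2) =
        derivs δ (fun p : Fin (d + 1) × Fin n ↦ u p.1.castSucc p.2) ∪
          derivs δ (u (Fin.last _)) := by
      ext; simp [derivs, Fin.exists_fin_succ']
    have hsplitζ : derivs δ (fun σ : Fin (d + 1) ↦ ζ σ.succ) =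
        derivs δ (fun σ : Fin d ↦ ζ σ.succ.castSucc) ∪
          Set.range fun k ↦ δ^[k] (ζ (Fin.last _)) := by
      ext; simp [derivs, Fin.exists_fin_succ']
    rw [hA', Fin.castSucc_zero] at this
    rw [hsplitu, hsplitζ, ← this]
    congr 2
    ac_rfl

end DifferentialElimination

theorem diffAdjoin_coe_closure {E : Type*} [Field E] (δ : E → E) (A S : Set E) :
    diffAdjoin δ (Subfield.closure A) S =
      Subfield.closure (A ∪ {x | ∃ s ∈ S, ∃ k : ℕ, δ^[k] s = x}) := by
  simp only [diffAdjoin, Subfield.closure_union, Subfield.closure_eq]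

theorem diffAdjoin_range {E ι : Type*} [Field E] (δ : E → E) (A : Set E) (a : ι → E) :
    diffAdjoin δ (Subfield.closure A) (Set.range a) = Subfield.closure (A ∪ derivs δ a) := by
  simp [diffAdjoin_coe_closure, derivs]

/-- **The order of the differential Chow form equals the order of the variety.**
Let `ξ` have differential dimension `d` and order `h` over `F`, let `u_{σρ}` be
differentially independent over `F⟨ξ₁,…,ξₙ⟩`, `ζ_σ = −∑_ρ u_{σρ} ξ_ρ`, and
`K = F⟨u_{σρ}⟩`.  Then the transcendence degree of `K⟨ζ₀,ζ₁,…,ζ_d⟩` over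
`K⟨ζ₁,…,ζ_d⟩` equals `h`. -/
theorem order_of_chow_form
    {E : Type*} [Field E] [CharZero E] (δ : E → E)
    (hδadd : ∀ a b : E, δ (a + b) = δ a + δ b)
    (hδmul : ∀ a b : E, δ (a * b) = a * δ b + δ a * b)
    (F : Subfield E) (hF : ∀ x ∈ F, δ x ∈ F)
    (n d h : ℕ) (ξ : Fin n → E)
    (hdim : HasDimOrder δ F ξ d h)
    (u : Fin (d + 1) → Fin n → E)
    (hu : DiffIndep δ (diffAdjoin δ F (Set.range ξ))
      (fun p : Fin (d + 1) × Fin n => u p.1 p.2))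
    (ζ : Fin (d + 1) → E) (hζ : ∀ σ, ζ σ = -∑ ρ : Fin n, u σ ρ * ξ ρ) :
    Trdeg (diffAdjoin δ (diffAdjoin δ F {x | ∃ σ ρ, u σ ρ = x})
        {x | ∃ σ : Fin d, ζ σ.succ = x})
      (IntermediateField.adjoin
        (diffAdjoin δ (diffAdjoin δ F {x | ∃ σ ρ, u σ ρ = x})
          {x | ∃ σ : Fin d, ζ σ.succ = x})
        {x : E | ∃ k : ℕ, δ^[k] (ζ 0) = x}) = (h : Cardinal) := by
  have hFcl : Subfield.closure (F : Set E) = F := Subfield.closure_eq F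
  have hA : ∀ a ∈ (F : Set E), δ a ∈ acl (F : Set E) := fun a ha ↦ subset_acl _ (hF a ha)
  obtain ⟨T, hT⟩ := hdim
  have hdim' : ∀ s ≥ T + 1,
      (algMatroid E ／ (F : Set E)).eRk (derivsLT δ ξ s) = (d * s + h : ℕ) := by
    rintro (_ | t) ht
    · omega
    · have := (trdeg_adjoin_eq_iff_eRk_eq hFcl.symm).1 (hT t (by omega))
      simpa only [derivsLT, Nat.lt_succ_iff] using this
  have hu' : IndepOver (F ∪ derivs δ ξ)
      fun p : (Fin (d + 1) × Fin n) × ℕ ↦ δ^[p.2] (u p.1.1 p.1.2) := by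
    have hK := diffAdjoin_range δ (F : Set E) ξ
    rw [hFcl] at hK
    rw [DiffIndep, hK] at hu
    exact hu.indepOver
  refine (trdeg_adjoin_eq_iff_eRk_eq ?_).2
    (eRk_range_iterate_of_generic hδadd hδmul hA hdim' hu' hζ)
  have hurange : {x | ∃ σ ρ, u σ ρ = x} = Set.range fun p : Fin (d + 1) × Fin n ↦ u p.1 p.2 := by
    ext; simp
  change diffAdjoin δ _ (Set.range fun σ : Fin d ↦ ζ σ.succ) = _
  rw [← diffAdjoin_range, ← diffAdjoin_range, hFcl, hurange]
end

section
/- In the Chow-form evaluation setup, let f ∈ R satisfy ev(f) = 0. Then for every ρ ∈ {1,…,n}, ev(∂f/∂u_{0ρ}^{(h)}) = ξ_ρ · ev(∂f/∂z_0^{(h)}). In particular, if ev(∂f/∂z_0^{(h)}) ≠ 0, then ξ_ρ = ev(∂f/∂u_{0ρ}^{(h)}) / ev(∂f/∂z_0^{(h)}) for every ρ, i.e., the coordinates of the generic point ξ are recovered from the differential Chow form by ratios of its formal partial derivatives evaluated at ζ. -/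
set_option synthInstance.maxHeartbeats 1000000
set_option maxHeartbeats 1000000

/-- The chain rule for a derivation applied to an evaluated polynomial. -/
theorem derivation_eval₂_eq_sum {ι S R A : Type*} [Fintype ι] [CommRing S] [CommRing R]
    [CommRing A] [Algebra R A] (φ : S →+* R) (D : Derivation R A A) (g : ι → A)
    (f : MvPolynomial ι S) :
    D (f.eval₂ ((algebraMap R A).comp φ) g) =
      ∑ i, (MvPolynomial.pderiv i f).eval₂ ((algebraMap R A).comp φ) g * D (g i) := by
  classical
  induction f using MvPolynomial.induction_on with
  | C a => simp
  | add p q hp hq => simp [MvPolynomial.eval₂_add, hp, hq, add_mul, Finset.sum_add_distrib]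
  | mul_X p j hp =>
    simp only [MvPolynomial.eval₂_mul, MvPolynomial.eval₂_X, Derivation.leibniz, hp,
      MvPolynomial.eval₂_add, smul_eq_mul, add_mul, Finset.sum_add_distrib,
      MvPolynomial.pderiv_X, Finset.mul_sum]
    congr 1
    · rw [Finset.sum_eq_single j]
      · simp
      · intro i _ hij
        simp [Pi.single_eq_of_ne hij.symm]
      · simp
    · exact Finset.sum_congr rfl fun i _ => by ring

/-- A derivative of a product `a * b` is linear in the derivatives of `a`, with leading
coefficient `b`. -/
theorem exists_mvPolynomial_aeval_iterate_mul {E τ : Type*} [Field E] [DecidableEq τ] (δ : E → E)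
    (hδadd : ∀ a b : E, δ (a + b) = δ a + δ b)
    (hδmul : ∀ a b : E, δ (a * b) = a * δ b + δ a * b)
    (K : Subfield E) (x : τ → E) (t : τ) (b : ℕ → K)
    (hb : ∀ i, δ (b i) = b (i + 1)) (h k j i : ℕ) (hjk : j + k ≤ h) :
    ∃ w : MvPolynomial (τ × ℕ) K,
      MvPolynomial.aeval (fun p : τ × ℕ => δ^[p.2] (x p.1)) w = δ^[k] (δ^[j] (x t) * b i) ∧
      ∀ s, MvPolynomial.pderiv (s, h) w =
        if s = t ∧ j + k = h then MvPolynomial.C (b i) else 0 := by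
  induction k generalizing j i with
  | zero =>
    refine ⟨MvPolynomial.X (t, j) * MvPolynomial.C (b i), ?_, fun s => ?_⟩
    · simp only [map_mul, MvPolynomial.aeval_X, MvPolynomial.aeval_C]
      rfl
    · by_cases hs : s = t ∧ j + 0 = h
      · obtain ⟨rfl, rfl⟩ := hs
        simp
      · rw [if_neg hs, Derivation.leibniz, MvPolynomial.pderiv_X_of_ne]
        · simp
        · intro h'
          apply hs
          simp_all
  | succ k ih =>
    obtain ⟨w₁, hw₁, hd₁⟩ := ih j (i + 1) (by omega)
    obtain ⟨w₂, hw₂, hd₂⟩ := ih (j + 1) i (by omega)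
    refine ⟨w₁ + w₂, ?_, fun s => ?_⟩
    · rw [map_add, hw₁, hw₂, Function.iterate_succ_apply δ k, hδmul, hb,
        ← Function.iterate_succ_apply' δ j]
      exact (iterate_map_add (AddMonoidHom.mk' δ hδadd) k _ _).symm
    · rw [map_add, hd₁, hd₂, if_neg (by omega), zero_add]
      congr 2
      grind

/-- A derivative of `-∑ u_ρ ξ_ρ` is linear in the derivatives of the `u_ρ`, with leading
coefficients `-ξ_ρ`. -/
theorem exists_mvPolynomial_aeval_iterate_neg_sum {E ι κ : Type*} [Field E] [Fintype ι]
    [DecidableEq ι] [DecidableEq κ] (δ : E → E)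
    (hδadd : ∀ a b : E, δ (a + b) = δ a + δ b)
    (hδmul : ∀ a b : E, δ (a * b) = a * δ b + δ a * b)
    (K : Subfield E) (u : κ → ι → E) (b : ι → ℕ → K)
    (hb : ∀ ρ i, δ (b ρ i) = b ρ (i + 1)) (σ : κ) (h k : ℕ) (hk : k ≤ h) :
    ∃ w : MvPolynomial ((κ × ι) × ℕ) K,
      MvPolynomial.aeval (fun p : (κ × ι) × ℕ => δ^[p.2] (u p.1.1 p.1.2)) w =
        δ^[k] (-∑ ρ, u σ ρ * b ρ 0) ∧
      ∀ σ' ρ, MvPolynomial.pderiv ((σ', ρ), h) w =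
        if σ' = σ ∧ k = h then -MvPolynomial.C (b ρ 0) else 0 := by
  choose w hw hd using fun ρ => exists_mvPolynomial_aeval_iterate_mul δ hδadd hδmul K
    (fun p : κ × ι => u p.1 p.2) (σ, ρ) (b ρ) (hb ρ) h k 0 0 (by omega)
  refine ⟨-∑ ρ, w ρ, ?_, fun σ' ρ => ?_⟩
  · have key := map_neg ((show AddMonoid.End E from AddMonoidHom.mk' δ hδadd) ^ k)
      (∑ ρ, u σ ρ * b ρ 0)
    rw [map_sum, AddMonoid.End.coe_pow] at key
    rw [map_neg, map_sum, Finset.sum_congr rfl fun ρ _ => hw ρ]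
    exact key.symm
  · simp only [map_neg, map_sum, hd, zero_add, Prod.mk.injEq]
    rw [Finset.sum_eq_single ρ (fun ρ' _ hne => by rw [if_neg]; tauto) (by simp)]
    simp only [and_true]
    split_ifs <;> simp

/-- **Recovering the generic point from the differential Chow form.**
In the Chow-form evaluation setup (indeterminates `u_{σρ}^{(k)}` and `z_σ^{(k)}`,
`0 ≤ σ ≤ d`, `1 ≤ ρ ≤ n`, `0 ≤ k ≤ h`; `ev` substitutes `δᵏ(u_{σρ})` and `δᵏ(ζ_σ)`
where `ζ_σ = −∑_ρ u_{σρ} ξ_ρ`), if `ev f = 0` then for every `ρ`,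
`ev(∂f/∂u_{0ρ}^{(h)}) = ξ_ρ · ev(∂f/∂z₀^{(h)})`; in particular if
`ev(∂f/∂z₀^{(h)}) ≠ 0` then `ξ_ρ = ev(∂f/∂u_{0ρ}^{(h)}) / ev(∂f/∂z₀^{(h)})`. -/
theorem chow_form_recovers_generic_point
    {E : Type*} [Field E] [CharZero E] (δ : E → E)
    (hδadd : ∀ a b : E, δ (a + b) = δ a + δ b)
    (hδmul : ∀ a b : E, δ (a * b) = a * δ b + δ a * b)
    (F : Subfield E) (hF : ∀ x ∈ F, δ x ∈ F)
    (n d h : ℕ) (hn : 1 ≤ n) (ξ : Fin n → E)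
    (u : Fin (d + 1) → Fin n → E)
    (hu : AlgebraicIndependent (diffAdjoin δ F (Set.range ξ))
      (fun p : (Fin (d + 1) × Fin n) × ℕ => δ^[p.2] (u p.1.1 p.1.2)))
    (ζ : Fin (d + 1) → E) (hζ : ∀ σ, ζ σ = -∑ ρ : Fin n, u σ ρ * ξ ρ)
    (ev : MvPolynomial
        ((Fin (d + 1) × Fin n × Fin (h + 1)) ⊕ (Fin (d + 1) × Fin (h + 1))) F →ₐ[F] E)
    (hev : ev = MvPolynomial.aeval
      (Sum.elim (fun q : Fin (d + 1) × Fin n × Fin (h + 1) => δ^[(q.2.2 : ℕ)] (u q.1 q.2.1))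
        (fun q : Fin (d + 1) × Fin (h + 1) => δ^[(q.2 : ℕ)] (ζ q.1))))
    (f : MvPolynomial
        ((Fin (d + 1) × Fin n × Fin (h + 1)) ⊕ (Fin (d + 1) × Fin (h + 1))) F)
    (hf : ev f = 0) :
    ∀ ρ : Fin n,
      ev (MvPolynomial.pderiv (Sum.inl (0, ρ, Fin.last h)) f)
          = ξ ρ * ev (MvPolynomial.pderiv (Sum.inr (0, Fin.last h)) f) ∧
        (ev (MvPolynomial.pderiv (Sum.inr (0, Fin.last h)) f) ≠ 0 →
          ξ ρ = ev (MvPolynomial.pderiv (Sum.inl (0, ρ, Fin.last h)) f)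
            / ev (MvPolynomial.pderiv (Sum.inr (0, Fin.last h)) f)) := by
  classical
  intro ρ
  suffices hmain : ev (MvPolynomial.pderiv (Sum.inl (0, ρ, Fin.last h)) f)
      = ξ ρ * ev (MvPolynomial.pderiv (Sum.inr (0, Fin.last h)) f) from
    ⟨hmain, fun hne => eq_div_of_mul_eq hne hmain.symm⟩
  set K := diffAdjoin δ F (Set.range ξ)
  have hFK : F ≤ K := fun x hx => Subfield.subset_closure (Or.inl hx)
  let b : Fin n → ℕ → K := fun ρ i =>
    ⟨δ^[i] (ξ ρ), Subfield.subset_closure (Or.inr ⟨ξ ρ, ⟨ρ, rfl⟩, i, rfl⟩)⟩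
  choose Z hZ hdZ using fun q : Fin (d + 1) × Fin (h + 1) =>
    exists_mvPolynomial_aeval_iterate_neg_sum δ hδadd hδmul K u b
      (fun ρ i => (Function.iterate_succ_apply' δ i (ξ ρ)).symm) q.1 h q.2 (by omega)
  let g : (Fin (d + 1) × Fin n × Fin (h + 1)) ⊕ (Fin (d + 1) × Fin (h + 1)) →
      MvPolynomial ((Fin (d + 1) × Fin n) × ℕ) K :=
    Sum.elim (fun q => MvPolynomial.X ((q.1, q.2.1), (q.2.2 : ℕ))) Z
  set Φ := (algebraMap K (MvPolynomial ((Fin (d + 1) × Fin n) × ℕ) K)).comp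
    (Subfield.inclusion hFK)
  set θ := MvPolynomial.aeval (R := K)
    (fun p : (Fin (d + 1) × Fin n) × ℕ => δ^[p.2] (u p.1.1 p.1.2))
  have hθ : ∀ p, θ (p.eval₂ Φ g) = ev p := by
    intro p
    have hcomp : (θ : _ →+* E).comp (MvPolynomial.eval₂Hom Φ g) = (ev : _ →+* E) := by
      apply MvPolynomial.ringHom_ext
      · intro r
        simp [Φ, hev]
        rfl
      · rintro (q | q)
        · simp [g, hev, θ]
        · simp [g, hev, hζ, hZ, b]
    exact congrArg (fun ψ => ψ p) hcomp
  have hΦf : f.eval₂ Φ g = 0 := hu (by rw [map_zero]; exact (hθ f).trans hf)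
  have hgu : MvPolynomial.pderiv ((0, ρ), h) (g (Sum.inl (0, ρ, Fin.last h))) = 1 :=
    MvPolynomial.pderiv_X_self _
  have hgz : MvPolynomial.pderiv ((0, ρ), h) (g (Sum.inr (0, Fin.last h))) =
      -MvPolynomial.C (b ρ 0) := by
    simp [g, hdZ]
  have hchain : _ = ∑ i, (MvPolynomial.pderiv i f).eval₂ Φ g *
      MvPolynomial.pderiv ((0, ρ), h) (g i) := derivation_eval₂_eq_sum (Subfield.inclusion hFK)
    (MvPolynomial.pderiv ((0, ρ), h)) g f
  rw [hΦf, map_zero, Fintype.sum_sum_type, Finset.sum_eq_single (0, ρ, Fin.last h),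
    Finset.sum_eq_single (0, Fin.last h)] at hchain
  · have hE := congrArg θ hchain
    have hbρ : θ (MvPolynomial.C (b ρ 0)) = ξ ρ := MvPolynomial.aeval_C _ _
    rw [hgu, hgz, map_zero, map_add, map_mul, map_mul, map_one, map_neg, hθ, hθ, hbρ] at hE
    linear_combination -hE
  · rintro ⟨σ, k⟩ - hne
    have hcond : ¬(0 = σ ∧ (k : ℕ) = h) := fun ⟨h0, hk⟩ =>
      hne (Prod.ext h0.symm (Fin.ext hk))
    simp only [g, Sum.elim_inr, hdZ, if_neg hcond, mul_zero]
  · simp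
  · rintro ⟨σ, ρ', k⟩ - hne
    simp only [g, Sum.elim_inl]
    rw [MvPolynomial.pderiv_X_of_ne, mul_zero]
    intro heq
    simp only [Prod.mk.injEq] at heq
    exact hne (Prod.ext heq.1.1 (Prod.ext heq.1.2 (Fin.ext heq.2)))
  · simp
end

section
/- In the Chow-form evaluation setup, assume f ∈ R is irreducible, ev(f) = 0, and every g ∈ R with ev(g) = 0 is divisible by f in R. For σ, τ ∈ {0,…,d} and i ≥ 0 define E_{σ,τ,i} = Σ_{k=0}^{h−i} binom(k+i, i) · ( z_τ^{(k)} · ∂f/∂z_σ^{(k+i)} + Σ_{j=1}^n u_{τj}^{(k)} · ∂f/∂u_{σj}^{(k+i)} ) ∈ R. Then there exists a nonnegative integer r such that: (1) E_{σ,σ,0} = r·f for every σ ∈ {0,…,d}; (2) E_{σ,τ,0} = 0 whenever σ ≠ τ; (3) E_{σ,σ,i} = 0 for every σ and every i with 1 ≤ i ≤ h. (These are the Euler-type identities expressing that the differential Chow form is differentially homogeneous of the same degree r in each block of variables (z_σ, u_{σ1}, …, u_{σn}).) -/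
set_option synthInstance.maxHeartbeats 1000000
set_option maxHeartbeats 1000000

/-- The Euler-type combination
`E_{σ,τ,i} = ∑_{k=0}^{h−i} C(k+i,i) ( z_τ^{(k)} ∂f/∂z_σ^{(k+i)} + ∑_j u_{τj}^{(k)} ∂f/∂u_{σj}^{(k+i)} )`,
formed from a polynomial `f` in the indeterminates `u_{σρ}^{(k)}` (coded `Sum.inl (σ,ρ,k)`)
and `z_σ^{(k)}` (coded `Sum.inr (σ,k)`). -/
noncomputable def eulerE {R : Type*} [CommRing R] (d n h : ℕ)
    (f : MvPolynomial ((Fin (d + 1) × Fin n × Fin (h + 1)) ⊕ (Fin (d + 1) × Fin (h + 1))) R)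
    (σ τ : Fin (d + 1)) (i : ℕ) :
    MvPolynomial ((Fin (d + 1) × Fin n × Fin (h + 1)) ⊕ (Fin (d + 1) × Fin (h + 1))) R :=
  ∑ k : Fin (h + 1),
    if hk : (k : ℕ) + i ≤ h then
      (Nat.choose ((k : ℕ) + i) i : MvPolynomial _ R) *
        (MvPolynomial.X (Sum.inr (τ, k)) *
            MvPolynomial.pderiv (Sum.inr (σ, ⟨(k : ℕ) + i, by omega⟩)) f
          + ∑ j : Fin n,
              MvPolynomial.X (Sum.inl (τ, j, k)) *
                MvPolynomial.pderiv (Sum.inl (σ, j, ⟨(k : ℕ) + i, by omega⟩)) f)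
    else 0


namespace ChowForm

open MvPolynomial Finset

section Derivation

variable {ι R : Type*} [CommRing R]

/-- Every monomial of `D p`, for `D` a derivation, arises from a monomial of `p` by replacing one
variable `v` by a monomial of `D (X v)`. -/
theorem exists_of_mem_support_mkDerivation (g : ι → MvPolynomial ι R) (p : MvPolynomial ι R)
    {m : ι →₀ ℕ} (hm : m ∈ (mkDerivation R g p).support) :
    ∃ m' ∈ p.support, ∃ v, ∃ s ∈ (g v).support,
      m + Finsupp.single v 1 = m' + s := by
  classical
  rw [p.as_sum, map_sum] at hm
  obtain ⟨m', hm', h⟩ := Finset.mem_biUnion.1 (support_sum hm)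
  refine ⟨m', hm', ?_⟩
  rw [mkDerivation_monomial, Finsupp.sum] at h
  obtain ⟨v, hv, h⟩ := Finset.mem_biUnion.1 (support_sum (support_smul h))
  rw [smul_eq_mul] at h
  obtain ⟨a, ha, s, hs, rfl⟩ := Finset.mem_add.1 (support_mul _ _ h)
  obtain rfl := Finset.mem_singleton.1 (support_monomial_subset ha)
  refine ⟨v, s, hs, ?_⟩
  rw [add_right_comm, Finsupp.sub_add_single_one_cancel (Finsupp.mem_support_iff.1 hv)]

theorem totalDegree_mkDerivation_le (g : ι → MvPolynomial ι R)
    (hg : ∀ v, (g v).totalDegree ≤ 1) (p : MvPolynomial ι R) :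
    (mkDerivation R g p).totalDegree ≤ p.totalDegree := by
  refine Finset.sup_le fun m hm => ?_
  obtain ⟨m', hm', v, s, hs, h⟩ := exists_of_mem_support_mkDerivation g p hm
  have h1 := congrArg Finsupp.degree h
  have h2 := (le_totalDegree hs).trans (hg v)
  have h3 := le_totalDegree hm'
  change s.degree ≤ 1 at h2
  change m'.degree ≤ _ at h3
  change m.degree ≤ _
  simp only [map_add, Finsupp.degree_single] at h1
  omega

/-- A derivation that strictly lowers weights has no nonzero eigenvalue. -/
theorem eq_zero_of_mkDerivation_eq_C_mul [IsDomain R] (w : ι → ℕ) (g : ι → MvPolynomial ι R)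
    (hg : ∀ v, ∀ s ∈ (g v).support, Finsupp.weight w s < w v) {p : MvPolynomial ι R} {c : R}
    (h : mkDerivation R g p = C c * p) : C c * p = 0 := by
  by_contra hcp
  have hc : c ≠ 0 := by rintro rfl; simp at hcp
  have hp : p ≠ 0 := by rintro rfl; simp at hcp
  obtain ⟨m, hm, hmax⟩ := p.support.exists_max_image (Finsupp.weight w)
    (Finset.nonempty_iff_ne_empty.2 (support_eq_empty.not.2 hp))
  have hm' : m ∈ (mkDerivation R g p).support := by
    rw [h, mem_support_iff, coeff_C_mul]
    exact mul_ne_zero hc (mem_support_iff.1 hm)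
  obtain ⟨m', hm', v, s, hs, e⟩ := exists_of_mem_support_mkDerivation g p hm'
  have h1 := congrArg (Finsupp.weight w) e
  simp only [map_add, Finsupp.weight_single, one_smul] at h1
  have := hmax m' hm'
  have := hg v s hs
  omega

theorem coeff_mkDerivation_smul_X (w : ι → ℕ) (p : MvPolynomial ι R) (m : ι →₀ ℕ) :
    coeff m (mkDerivation R (fun v => w v • (X v : MvPolynomial ι R)) p) =
      (Finsupp.weight w m : R) * coeff m p := by
  classical
  induction p using MvPolynomial.induction_on' with
  | add p q hp hq => simp only [map_add, coeff_add, hp, hq, mul_add]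
  | monomial s r =>
    have : mkDerivation R (fun v => w v • (X v : MvPolynomial ι R)) (monomial s r) =
        (Finsupp.weight w s) • monomial s r := by
      rw [mkDerivation_monomial, Finsupp.weight_apply, Finsupp.sum, Finsupp.sum, Finset.smul_sum,
        Finset.sum_smul]
      refine Finset.sum_congr rfl fun v hv => ?_
      rw [smul_eq_mul, mul_smul_comm, smul_comm, ← smul_mul_assoc, smul_monomial, smul_eq_mul,
        ← pderiv_monomial, mul_comm, X_mul_pderiv_monomial, smul_smul, smul_eq_mul, mul_comm]
    rw [this, coeff_smul, coeff_monomial]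
    split_ifs with hs
    · rw [hs, nsmul_eq_mul]
    · simp

end Derivation

section Leibniz

theorem sum_choose_mul_choose_mul {S : Type*} [CommSemiring S] (G : ℕ → ℕ → S) (k i : ℕ) :
    ∑ p ∈ antidiagonal k, (k.choose p.1 : S) * ((p.1.choose i : S) * G (p.1 - i) p.2) =
      (k.choose i : S) *
        ∑ p ∈ antidiagonal (k - i), ((k - i).choose p.1 : S) * G p.1 p.2 := by
  obtain hk | hk := lt_or_ge k i
  · rw [Nat.choose_eq_zero_of_lt hk, Nat.cast_zero, zero_mul]
    refine Finset.sum_eq_zero fun p hp => ?_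
    rw [HasAntidiagonal.mem_antidiagonal] at hp
    rw [Nat.choose_eq_zero_of_lt (by omega : p.1 < i)]
    simp
  · obtain ⟨m, rfl⟩ := Nat.exists_eq_add_of_le hk
    rw [Nat.add_sub_cancel_left]
    simp only [Nat.sum_antidiagonal_eq_sum_range_succ_mk]
    rw [Nat.succ_eq_add_one, add_assoc, Finset.sum_range_add, Finset.sum_eq_zero, zero_add, Finset.mul_sum]
    · refine Finset.sum_congr rfl fun a _ => ?_
      rw [← mul_assoc, ← mul_assoc, ← Nat.cast_mul, ← Nat.cast_mul,
        Nat.choose_mul (Nat.le_add_right i a), Nat.add_sub_cancel_left, Nat.add_sub_cancel_left,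
        Nat.add_sub_add_left]
    · intro a ha
      rw [Nat.choose_eq_zero_of_lt (Finset.mem_range.1 ha)]
      simp

theorem iterate_mul {E : Type*} [CommRing E] (δ : AddMonoid.End E)
    (hδ : ∀ a b : E, δ (a * b) = a * δ b + δ a * b) (k : ℕ) (a b : E) :
    (δ ^ k) (a * b) =
      ∑ p ∈ antidiagonal k, (k.choose p.1 : E) * ((δ ^ p.1) a * (δ ^ p.2) b) := by
  induction k with
  | zero => simp
  | succ k ih =>
    rw [sum_antidiagonal_choose_succ_mul (fun i j => (δ ^ i) a * (δ ^ j) b), pow_succ',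
      AddMonoid.End.coe_mul, Function.comp_apply, ih, map_sum, ← Finset.sum_add_distrib]
    refine Finset.sum_congr rfl fun p hp => ?_
    rw [Nat.choose_symm_of_eq_add (HasAntidiagonal.mem_antidiagonal.1 hp).symm, ← nsmul_eq_mul, map_nsmul, hδ,
      nsmul_eq_mul, mul_add, pow_succ', pow_succ', Nat.choose_symm_of_eq_add
      (by rw [add_comm]; exact (HasAntidiagonal.mem_antidiagonal.1 hp).symm)]
    rfl

end Leibniz

section Euler

/-- The indeterminates `u_{σρ}^{(k)}` and `z_σ^{(k)}`. -/
abbrev Var (d n h : ℕ) : Type :=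
  (Fin (d + 1) × Fin n × Fin (h + 1)) ⊕ (Fin (d + 1) × Fin (h + 1))

variable {d n h : ℕ}

/-- The index `σ` of the block to which a variable belongs. -/
def Var.block : Var d n h → Fin (d + 1) := Sum.elim (fun q => q.1) (fun q => q.1)

/-- The order of derivation of a variable. -/
def Var.order : Var d n h → ℕ := Sum.elim (fun q => q.2.2) (fun q => q.2)

/-- Move a variable to the block `τ` and lower its order by `i`. -/
def Var.shift (τ : Fin (d + 1)) (i : ℕ) : Var d n h → Var d n h :=
  Sum.map (fun q => (τ, q.2.1, ⟨q.2.2 - i, by omega⟩)) (fun q => (τ, ⟨q.2 - i, by omega⟩))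

@[simp]
theorem Var.block_shift (τ : Fin (d + 1)) (i : ℕ) (v : Var d n h) : (v.shift τ i).block = τ := by
  rcases v with v | v <;> rfl

@[simp]
theorem Var.order_shift (τ : Fin (d + 1)) (i : ℕ) (v : Var d n h) :
    (v.shift τ i).order = v.order - i := by
  rcases v with v | v <;> rfl

theorem Var.shift_block_zero (v : Var d n h) : v.shift v.block 0 = v := by
  rcases v with v | v <;> rfl

theorem Var.shift_shift_zero (σ τ : Fin (d + 1)) (v : Var d n h) :
    (v.shift τ 0).shift σ 0 = v.shift σ 0 := by
  rcases v with v | v <;> rfl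

variable {R : Type*} [CommRing R]

/-- The value of the derivation underlying `eulerE` on a variable. -/
noncomputable def eulerVal (R : Type*) [CommRing R] (σ τ : Fin (d + 1)) (i : ℕ) (v : Var d n h) :
    MvPolynomial (Var d n h) R :=
  if v.block = σ then (v.order.choose i : MvPolynomial (Var d n h) R) * X (v.shift τ i) else 0

theorem derivation_sum_apply {ι κ : Type*} (s : Finset κ)
    (D : κ → Derivation R (MvPolynomial ι R) (MvPolynomial ι R)) (q : MvPolynomial ι R) :
    (∑ k ∈ s, D k) q = ∑ k ∈ s, D k q := by
  rw [← Derivation.coeFnAddMonoidHom_apply, map_sum, Finset.sum_apply]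
  rfl

theorem eulerE_eq_mkDerivation (σ τ : Fin (d + 1)) (i : ℕ) (p : MvPolynomial (Var d n h) R) :
    eulerE d n h p σ τ i = mkDerivation R (eulerVal R σ τ i) p := by
  let D : Derivation R (MvPolynomial (Var d n h) R) (MvPolynomial (Var d n h) R) :=
    ∑ k : Fin (h + 1), if hk : (k : ℕ) + i ≤ h then
      (Nat.choose ((k : ℕ) + i) i : MvPolynomial (Var d n h) R) •
        ((X (Sum.inr (τ, k)) : MvPolynomial (Var d n h) R) •
            (pderiv (Sum.inr (σ, ⟨(k : ℕ) + i, by omega⟩)) :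
              Derivation R (MvPolynomial (Var d n h) R) (MvPolynomial (Var d n h) R))
          + ∑ j : Fin n, (X (Sum.inl (τ, j, k)) : MvPolynomial (Var d n h) R) •
                (pderiv (Sum.inl (σ, j, ⟨(k : ℕ) + i, by omega⟩)) :
              Derivation R (MvPolynomial (Var d n h) R) (MvPolynomial (Var d n h) R)))
    else 0
  have hD (q : MvPolynomial (Var d n h) R) : D q = eulerE d n h q σ τ i := by
    rw [eulerE, derivation_sum_apply]
    refine Finset.sum_congr rfl fun k _ => ?_
    split_ifs
    · rw [Derivation.smul_apply, Derivation.add_apply, Derivation.smul_apply,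
        derivation_sum_apply]
      rfl
    · rfl
  rw [← hD]
  congr 1
  refine derivation_ext fun v => ?_
  rw [hD, mkDerivation_X, eulerE, eulerVal]
  rcases v with ⟨σ', j', k'⟩ | ⟨σ', k'⟩
  · change _ = if σ' = σ then ((k' : ℕ).choose i : MvPolynomial (Var d n h) R) *
      X (Sum.inl (τ, j', ⟨k' - i, by omega⟩)) else 0
    have hk' := k'.2
    have hz (k : Fin (h + 1)) (hk : (k : ℕ) + i ≤ h) (hne : σ' ≠ σ ∨ (k : ℕ) + i ≠ k')
        (j : Fin n) : pderiv (Sum.inl (σ, j, ⟨(k : ℕ) + i, by omega⟩) : Var d n h)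
          (X (Sum.inl (σ', j', k')) : MvPolynomial (Var d n h) R) = 0 := by
      refine pderiv_X_of_ne fun e => ?_
      simp only [Sum.inl.injEq, Prod.mk.injEq, Fin.ext_iff] at e hne
      omega
    by_cases hi : i ≤ k' ∧ σ' = σ
    · obtain ⟨hi, rfl⟩ := hi
      rw [Finset.sum_eq_single ⟨k' - i, by omega⟩]
      · rw [dif_pos (by simp only; omega), pderiv_X_of_ne (by simp), mul_zero, zero_add,
          Finset.sum_eq_single j']
        · simp [Nat.sub_add_cancel hi]
        · intro j _ hj
          rw [pderiv_X_of_ne (by simp [hj.symm]), mul_zero]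
        · simp
      · intro k _ hk
        split_ifs with h1
        · rw [pderiv_X_of_ne (by simp), Finset.sum_eq_zero, mul_zero, add_zero, mul_zero]
          intro j _
          rw [hz k h1 (Or.inr fun e => hk (Fin.ext (by simp only; omega))), mul_zero]
        · rfl
      · simp
    · rw [Finset.sum_eq_zero]
      · split_ifs with h1
        · rw [Nat.choose_eq_zero_of_lt (not_le.1 fun h2 => hi ⟨h2, h1⟩), Nat.cast_zero, zero_mul]
        · rfl
      · intro k _
        split_ifs with h1
        · rw [pderiv_X_of_ne (by simp), Finset.sum_eq_zero, mul_zero, add_zero, mul_zero]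
          intro j _
          rw [hz k h1 (by by_contra! e; exact hi ⟨by omega, e.1⟩), mul_zero]
        · rfl
  · change _ = if σ' = σ then ((k' : ℕ).choose i : MvPolynomial (Var d n h) R) *
      X (Sum.inr (τ, ⟨k' - i, by omega⟩)) else 0
    have hk' := k'.2
    have hz (k : Fin (h + 1)) (hk : (k : ℕ) + i ≤ h) (hne : σ' ≠ σ ∨ (k : ℕ) + i ≠ k') :
        pderiv (Sum.inr (σ, ⟨(k : ℕ) + i, by omega⟩) : Var d n h)
          (X (Sum.inr (σ', k')) : MvPolynomial (Var d n h) R) = 0 := by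
      refine pderiv_X_of_ne fun e => ?_
      simp only [Sum.inr.injEq, Prod.mk.injEq, Fin.ext_iff] at e hne
      omega
    have hz' (k : Fin (h + 1)) (hk : (k : ℕ) + i ≤ h) :
        ∑ j : Fin n, (X (Sum.inl (τ, j, k)) : MvPolynomial (Var d n h) R) *
          pderiv (Sum.inl (σ, j, ⟨(k : ℕ) + i, by omega⟩) : Var d n h)
            (X (Sum.inr (σ', k')) : MvPolynomial (Var d n h) R) = 0 :=
      Finset.sum_eq_zero fun j _ => by rw [pderiv_X_of_ne (by simp), mul_zero]
    by_cases hi : i ≤ k' ∧ σ' = σ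
    · obtain ⟨hi, rfl⟩ := hi
      rw [Finset.sum_eq_single ⟨k' - i, by omega⟩]
      · rw [dif_pos (by simp only; omega), hz' _ (by simp only; omega), add_zero]
        simp [Nat.sub_add_cancel hi]
      · intro k _ hk
        split_ifs with h1
        · rw [hz' k h1, hz k h1 (Or.inr fun e => hk (Fin.ext (by simp only; omega))), mul_zero,
            add_zero, mul_zero]
        · rfl
      · simp
    · rw [Finset.sum_eq_zero]
      · split_ifs with h1
        · rw [Nat.choose_eq_zero_of_lt (not_le.1 fun h2 => hi ⟨h2, h1⟩), Nat.cast_zero, zero_mul]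
        · rfl
      · intro k _
        split_ifs with h1
        · rw [hz' k h1, hz k h1 (by by_contra! e; exact hi ⟨by omega, e.1⟩), mul_zero,
            add_zero, mul_zero]
        · rfl

theorem exists_eulerE_eq_C_mul [IsDomain R] {p : MvPolynomial (Var d n h) R} (hp : p ≠ 0)
    {σ τ : Fin (d + 1)} {i : ℕ} (hdvd : p ∣ eulerE d n h p σ τ i) :
    ∃ c : R, eulerE d n h p σ τ i = C c * p := by
  obtain ⟨q, hq⟩ := hdvd
  by_cases hq0 : q = 0
  · exact ⟨0, by simp [hq, hq0]⟩
  have hle : (eulerE d n h p σ τ i).totalDegree ≤ p.totalDegree := by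
    rw [eulerE_eq_mkDerivation]
    refine totalDegree_mkDerivation_le _ (fun v => ?_) p
    rw [eulerVal]
    split_ifs
    · refine (totalDegree_mul _ _).trans ?_
      rw [← map_natCast (C : R →+* MvPolynomial (Var d n h) R), totalDegree_C, zero_add]
      exact (totalDegree_X _).le
    · simp
  rw [hq, totalDegree_mul_of_isDomain hp hq0] at hle
  have := totalDegree_eq_zero_iff_eq_C.1 (by omega : q.totalDegree = 0)
  exact ⟨q.coeff 0, by rw [← this, hq, mul_comm]⟩

theorem weight_lt_of_mem_support_eulerVal (w : Var d n h → ℕ) {σ τ : Fin (d + 1)} {i : ℕ}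
    (hw : ∀ v : Var d n h, v.block = σ → i ≤ v.order → w (v.shift τ i) < w v)
    (v : Var d n h) (s : Var d n h →₀ ℕ) (hs : s ∈ (eulerVal R σ τ i v).support) :
    Finsupp.weight w s < w v := by
  rw [eulerVal] at hs
  split_ifs at hs with hv
  · by_cases hi : i ≤ v.order
    · rw [← map_natCast (C : R →+* MvPolynomial (Var d n h) R), C_mul'] at hs
      obtain rfl := Finset.mem_singleton.1 (support_monomial_subset (support_smul hs))
      simpa [Finsupp.weight_single] using hw v hv hi
    · simp [Nat.choose_eq_zero_of_lt (not_le.1 hi)] at hs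
  · simp at hs

theorem eulerE_eq_zero_of_ne [IsDomain R] {p : MvPolynomial (Var d n h) R} (hp : p ≠ 0)
    {σ τ : Fin (d + 1)} (hστ : σ ≠ τ) (hdvd : p ∣ eulerE d n h p σ τ 0) :
    eulerE d n h p σ τ 0 = 0 := by
  obtain ⟨c, hc⟩ := exists_eulerE_eq_C_mul hp hdvd
  rw [hc]
  rw [eulerE_eq_mkDerivation] at hc
  refine eq_zero_of_mkDerivation_eq_C_mul (fun v => if v.block = σ then 1 else 0) _
    (weight_lt_of_mem_support_eulerVal _ fun v hv _ => ?_) hc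
  simp [hv, hστ.symm]

theorem eulerE_eq_zero_of_pos [IsDomain R] {p : MvPolynomial (Var d n h) R} (hp : p ≠ 0)
    {σ τ : Fin (d + 1)} {i : ℕ} (hi : 1 ≤ i) (hdvd : p ∣ eulerE d n h p σ τ i) :
    eulerE d n h p σ τ i = 0 := by
  obtain ⟨c, hc⟩ := exists_eulerE_eq_C_mul hp hdvd
  rw [hc]
  rw [eulerE_eq_mkDerivation] at hc
  refine eq_zero_of_mkDerivation_eq_C_mul Var.order _
    (weight_lt_of_mem_support_eulerVal _ fun v hv hv' => ?_) hc
  rw [Var.order_shift]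
  omega

theorem exists_eulerE_eq_natCast_mul [IsDomain R] {p : MvPolynomial (Var d n h) R} (hp : p ≠ 0)
    {σ : Fin (d + 1)} (hdvd : p ∣ eulerE d n h p σ σ 0) :
    ∃ r : ℕ, eulerE d n h p σ σ 0 = (r : MvPolynomial (Var d n h) R) * p := by
  obtain ⟨c, hc⟩ := exists_eulerE_eq_C_mul hp hdvd
  obtain ⟨m, hm⟩ := ne_zero_iff.1 hp
  let w : Var d n h → ℕ := fun v => if v.block = σ then 1 else 0
  have hval : eulerVal R σ σ 0 = fun v : Var d n h => w v • (X v : MvPolynomial (Var d n h) R) := by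
    funext v
    by_cases hv : v.block = σ
    · subst hv
      simp [eulerVal, w, Var.shift_block_zero]
    · simp [eulerVal, w, hv]
  have h1 : coeff m (eulerE d n h p σ σ 0) = (Finsupp.weight w m : R) * coeff m p := by
    rw [eulerE_eq_mkDerivation, hval, coeff_mkDerivation_smul_X]
  rw [hc, coeff_C_mul] at h1
  exact ⟨Finsupp.weight w m, by rw [hc, mul_right_cancel₀ hm h1, map_natCast]⟩

/-- `E_{σ,τ,0}` and `E_{τ,σ,0}` have commutator `E_{τ,τ,0} - E_{σ,σ,0}`. -/
theorem eulerE_commutator {σ τ : Fin (d + 1)} (hστ : σ ≠ τ) (p : MvPolynomial (Var d n h) R) :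
    eulerE d n h (eulerE d n h p τ σ 0) σ τ 0 - eulerE d n h (eulerE d n h p σ τ 0) τ σ 0 =
      eulerE d n h p τ τ 0 - eulerE d n h p σ σ 0 := by
  simp only [eulerE_eq_mkDerivation]
  rw [← Derivation.commutator_apply, ← Derivation.sub_apply]
  congr 1
  refine derivation_ext fun (v : Var d n h) => ?_
  rw [Derivation.commutator_apply, Derivation.sub_apply]
  simp only [mkDerivation_X]
  have key (α β α' β' : Fin (d + 1)) : mkDerivation R (eulerVal R α β 0) (eulerVal R α' β' 0 v) =
      if v.block = α' ∧ β' = α then (X (v.shift β 0) : MvPolynomial (Var d n h) R) else 0 := by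
    by_cases h1 : v.block = α'
    · simp [h1, eulerVal, Var.shift_shift_zero]
    · simp [h1, eulerVal]
  rw [key, key]
  by_cases h1 : v.block = σ <;> by_cases h2 : v.block = τ <;> simp_all [eulerVal]

end Euler

section Generic

variable {d n h : ℕ} {R K : Type*} [CommRing R] [CommRing K]

/-- Substitution of the generic hyperplane relations `z_σ = -∑_j u_{σj} ξ_j` and their formal
derivatives, where `c j k` stands for the `k`-th derivative of `ξ_j`. -/
noncomputable def genericSubst (d h : ℕ) (φ : R →+* K) (c : Fin n → ℕ → K) :
    MvPolynomial (Var d n h) R →+* MvPolynomial ((Fin (d + 1) × Fin n) × ℕ) K :=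
  eval₂Hom (C.comp φ) (Sum.elim (fun q => X ((q.1, q.2.1), (q.2.2 : ℕ)))
    (fun q => -∑ j : Fin n, ∑ p ∈ antidiagonal (q.2 : ℕ),
      ((q.2 : ℕ).choose p.1 : MvPolynomial ((Fin (d + 1) × Fin n) × ℕ) K) *
        (X ((q.1, j), p.1) * C (c j p.2))))

/-- The derivation of the ring of generic coefficients corresponding to `eulerE`. -/
noncomputable def genericEuler (K : Type*) [CommRing K] (n : ℕ) (σ τ : Fin (d + 1)) (i : ℕ) :
    Derivation K (MvPolynomial ((Fin (d + 1) × Fin n) × ℕ) K)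
      (MvPolynomial ((Fin (d + 1) × Fin n) × ℕ) K) :=
  mkDerivation K fun q => if q.1.1 = σ then
    (q.2.choose i : MvPolynomial ((Fin (d + 1) × Fin n) × ℕ) K) * X ((τ, q.1.2), q.2 - i) else 0

theorem genericEuler_genericSubst (φ : R →+* K) (c : Fin n → ℕ → K) (σ τ : Fin (d + 1)) (i : ℕ)
    (p : MvPolynomial (Var d n h) R) :
    genericEuler K n σ τ i (genericSubst d h φ c p) =
      genericSubst d h φ c (eulerE d n h p σ τ i) := by
  rw [eulerE_eq_mkDerivation]
  induction p using MvPolynomial.induction_on with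
  | C a => simp [genericSubst]
  | add p q hp hq => simp only [map_add, hp, hq]
  | mul_X p v hp =>
    have hv : genericEuler K n σ τ i (genericSubst d h φ c (X v)) =
        genericSubst d h φ c (eulerVal R σ τ i v) := by
      rcases v with ⟨σ', j', k'⟩ | ⟨σ', k'⟩
      · rw [eulerVal]
        change _ = genericSubst d h φ c (if σ' = σ then _ else _)
        by_cases hσ : σ' = σ
        · simp [hσ, genericSubst, genericEuler, Var.order, Var.shift]
        · simp [hσ, genericSubst, genericEuler]
      · rw [eulerVal]
        change _ = genericSubst d h φ c (if σ' = σ then _ else _)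
        by_cases hσ : σ' = σ
        · subst hσ
          simp only [genericSubst, genericEuler, coe_eval₂Hom, eval₂_X, Sum.elim_inr, map_neg,
            map_sum, if_true, eval₂_mul, eval₂_natCast, Var.order, Var.shift, Sum.map_inr, mul_neg,
            Finset.mul_sum (s := univ)]
          congr 1
          refine Finset.sum_congr rfl fun j _ => ?_
          rw [← sum_choose_mul_choose_mul (fun a b => (X ((τ, j), a) * C (c j b) :
            MvPolynomial ((Fin (d + 1) × Fin n) × ℕ) K))]
          refine Finset.sum_congr rfl fun p _ => ?_
          rw [Derivation.leibniz, Derivation.leibniz, Derivation.map_natCast, derivation_C,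
            mkDerivation_X]
          simp only [if_true, smul_eq_mul]
          ring
        · simp [hσ, genericSubst, genericEuler]
    rw [map_mul, Derivation.leibniz, hv, hp, Derivation.leibniz, mkDerivation_X, map_add,
      smul_eq_mul, smul_eq_mul, smul_eq_mul, smul_eq_mul, map_mul, map_mul]

end Generic

end ChowForm

/-- **Euler-type identities: the differential Chow form is differentially homogeneous.**
In the Chow-form evaluation setup, if `f` is irreducible, `ev f = 0`, and `f` divides
every polynomial killed by `ev`, then there is `r : ℕ` with `E_{σ,σ,0} = r·f`,
`E_{σ,τ,0} = 0` for `σ ≠ τ`, and `E_{σ,σ,i} = 0` for `1 ≤ i ≤ h`. -/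
theorem chow_form_euler_identities
    {E : Type*} [Field E] [CharZero E] (δ : E → E)
    (hδadd : ∀ a b : E, δ (a + b) = δ a + δ b)
    (hδmul : ∀ a b : E, δ (a * b) = a * δ b + δ a * b)
    (F : Subfield E) (hF : ∀ x ∈ F, δ x ∈ F)
    (n d h : ℕ) (hn : 1 ≤ n) (ξ : Fin n → E)
    (u : Fin (d + 1) → Fin n → E)
    (hu : AlgebraicIndependent (diffAdjoin δ F (Set.range ξ))
      (fun p : (Fin (d + 1) × Fin n) × ℕ => δ^[p.2] (u p.1.1 p.1.2)))
    (ζ : Fin (d + 1) → E) (hζ : ∀ σ, ζ σ = -∑ ρ : Fin n, u σ ρ * ξ ρ)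
    (ev : MvPolynomial
        ((Fin (d + 1) × Fin n × Fin (h + 1)) ⊕ (Fin (d + 1) × Fin (h + 1))) F →ₐ[F] E)
    (hev : ev = MvPolynomial.aeval
      (Sum.elim (fun q : Fin (d + 1) × Fin n × Fin (h + 1) => δ^[(q.2.2 : ℕ)] (u q.1 q.2.1))
        (fun q : Fin (d + 1) × Fin (h + 1) => δ^[(q.2 : ℕ)] (ζ q.1))))
    (f : MvPolynomial
        ((Fin (d + 1) × Fin n × Fin (h + 1)) ⊕ (Fin (d + 1) × Fin (h + 1))) F)
    (hirr : Irreducible f) (hf : ev f = 0)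
    (hdiv : ∀ g, ev g = 0 → f ∣ g) :
    ∃ r : ℕ,
      (∀ σ : Fin (d + 1), eulerE d n h f σ σ 0 = (r : MvPolynomial _ F) * f) ∧
      (∀ σ τ : Fin (d + 1), σ ≠ τ → eulerE d n h f σ τ 0 = 0) ∧
      (∀ σ : Fin (d + 1), ∀ i : ℕ, 1 ≤ i → i ≤ h → eulerE d n h f σ σ i = 0) := by
  classical
  let D : AddMonoid.End E := AddMonoidHom.mk' δ hδadd
  have hDpow (k : ℕ) (x : E) : δ^[k] x = (D ^ k) x := by
    rw [AddMonoid.End.coe_pow]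
    rfl
  have hFK : F ≤ diffAdjoin δ F (Set.range ξ) :=
    fun x hx => Subfield.subset_closure (Or.inl hx)
  have hξ (j : Fin n) (k : ℕ) : δ^[k] (ξ j) ∈ diffAdjoin δ F (Set.range ξ) :=
    Subfield.subset_closure (Or.inr ⟨ξ j, ⟨j, rfl⟩, k, rfl⟩)
  let Ψ := ChowForm.genericSubst d h (Subfield.inclusion hFK) fun j k => ⟨δ^[k] (ξ j), hξ j k⟩
  let ε := MvPolynomial.aeval (R := diffAdjoin δ F (Set.range ξ))
    (fun p : (Fin (d + 1) × Fin n) × ℕ => δ^[p.2] (u p.1.1 p.1.2))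
  have hcomp (g : MvPolynomial (ChowForm.Var d n h) F) : ε (Ψ g) = ev g := by
    suffices H : (ε : _ →+* E).comp Ψ = (ev : _ →+* E) from congrArg (fun φ => φ g) H
    refine MvPolynomial.ringHom_ext (fun a => ?_) fun v => ?_
    · simp [Ψ, ε, ChowForm.genericSubst, hev, Subfield.inclusion]
      rfl
    · rcases v with ⟨σ, j, k⟩ | ⟨σ, k⟩
      · simp [Ψ, ε, ChowForm.genericSubst, hev]
      · have hz : δ^[k] (ζ σ) = -∑ j : Fin n, ∑ p ∈ Finset.HasAntidiagonal.antidiagonal (k : ℕ),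
            ((k : ℕ).choose p.1 : E) * (δ^[p.1] (u σ j) * δ^[p.2] (ξ j)) := by
          simp only [hDpow, hζ, map_neg, map_sum]
          congr 1
          exact Finset.sum_congr rfl fun j _ => ChowForm.iterate_mul D hδmul _ _ _
        simp [Ψ, ε, ChowForm.genericSubst, hev, hz]
        rfl
  have hf0 : Ψ f = 0 := hu (by rw [map_zero]; exact (hcomp f).trans hf)
  have hdvd (σ τ : Fin (d + 1)) (i : ℕ) : f ∣ eulerE d n h f σ τ i := by
    refine hdiv _ ?_
    rw [← hcomp, ← ChowForm.genericEuler_genericSubst]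
    change ε (ChowForm.genericEuler _ n σ τ i (Ψ f)) = 0
    rw [hf0, map_zero, map_zero]
  have hf1 : f ≠ 0 := hirr.ne_zero
  obtain ⟨r, hr⟩ := ChowForm.exists_eulerE_eq_natCast_mul hf1 (hdvd 0 0 0)
  refine ⟨r, fun σ => ?_, fun σ τ hστ => ChowForm.eulerE_eq_zero_of_ne hf1 hστ (hdvd σ τ 0),
    fun σ i hi _ => ChowForm.eulerE_eq_zero_of_pos hf1 hi (hdvd σ σ i)⟩
  by_cases hσ : σ = 0
  · rw [hσ, hr]
  · have h1 := ChowForm.eulerE_commutator hσ f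
    have h0 (α β : Fin (d + 1)) : eulerE d n h (0 : MvPolynomial _ F) α β 0 = 0 := by
      rw [ChowForm.eulerE_eq_mkDerivation, map_zero]
    rw [ChowForm.eulerE_eq_zero_of_ne hf1 hσ (hdvd σ 0 0),
      ChowForm.eulerE_eq_zero_of_ne hf1 (Ne.symm hσ) (hdvd 0 σ 0), h0, h0, sub_zero] at h1
    rw [← hr, ← sub_eq_zero.1 h1.symm]
end

section
/- Let F be an ordinary differential field of characteristic zero and E a differential field extension of F. Let ξ = (ξ_1,…,ξ_n) ∈ E^n and d ∈ ℕ be such that the differential transcendence degree of F⟨ξ_1,…,ξ_n⟩ over F is d (there is a d-element subset T ⊆ {1,…,n} with (ξ_i)_{i∈T} differentially independent over F, and every (d+1)-element subset is differentially dependent over F). For each i ∈ {0,…,d} fix natural numbers s_i ≥ 0 and m_i ≥ 1, let M_i be the set of exponent vectors α = (α_{jk})_{1≤j≤n, 0≤k≤s_i} with 1 ≤ |α| ≤ m_i, and write ξ^α = Π_{j,k} (δ^k ξ_j)^{α_{jk}}. Let the combined family (u_{iα})_{0≤i≤d, α∈M_i} of elements of E be differentially independent over F⟨ξ_1,…,ξ_n⟩,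 set ζ_i = −Σ_{α∈M_i} u_{iα} ξ^α, and let K = F⟨u_{iα} : 0 ≤ i ≤ d, α ∈ M_i⟩. Then ζ_0,…,ζ_d are differentially dependent over K, and if d > 0, then for each i ∈ {0,…,d} the d elements (ζ_j)_{j≠i} are differentially independent over K (so the differential transcendence degree of K⟨ζ_0,…,ζ_d⟩ over K equals d, and any d of the ζ's form a differential transcendence basis). -/
set_option synthInstance.maxHeartbeats 1000000
set_option maxHeartbeats 1000000

/-- The set of exponent vectors `α = (α_{jk})_{1≤j≤n, 0≤k≤s}` of nonnegative integers
with `1 ≤ |α| ≤ m`. -/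
abbrev GenMon (n s m : ℕ) : Type :=
  {α : Fin n × Fin (s + 1) → Fin (m + 1) //
    1 ≤ ∑ p : Fin n × Fin (s + 1), ((α p : ℕ)) ∧ ∑ p : Fin n × Fin (s + 1), ((α p : ℕ)) ≤ m}

/-- The monomial value `ξ^α = ∏_{j,k} (δᵏ ξⱼ)^{α_{jk}}`. -/
noncomputable def monValue {E : Type*} [Field E] (δ : E → E) {n : ℕ} (s m : ℕ)
    (ξ : Fin n → E) (α : GenMon n s m) : E :=
  ∏ p : Fin n × Fin (s + 1), (δ^[(p.2 : ℕ)] (ξ p.1)) ^ ((α.1 p : ℕ))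


/-- If the constant coefficients of a family of polynomials are algebraically independent over `R`,
then the family together with the variables is algebraically independent over `R`. -/
theorem MvPolynomial.algebraicIndependent_sumElim_X_of_constantCoeff
    {R L σ ι : Type*} [CommRing R] [CommRing L] [Algebra R L] (f : ι → MvPolynomial σ L)
    (hf : AlgebraicIndependent R (fun i => constantCoeff (f i))) :
    AlgebraicIndependent R (Sum.elim (X : σ → MvPolynomial σ L) f) := by
  have key : ∀ q : MvPolynomial σ (MvPolynomial ι R),
      q.eval₂ (aeval f : MvPolynomial ι R →ₐ[R] MvPolynomial σ L).toRingHom X = 0 → q = 0 := by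
    intro q hq
    by_contra hne
    obtain ⟨β, hβ⟩ := q.support.exists_minimal (support_nonempty.mpr hne)
    have hmon : ∀ γ : σ →₀ ℕ, ∏ i ∈ γ.support, (X i : MvPolynomial σ L) ^ γ i = monomial γ 1 :=
      fun γ => by rw [monomial_eq, C_1, one_mul, Finsupp.prod]
    have hcoeff := congrArg (coeff β) hq
    simp only [eval₂_eq, hmon, coeff_sum, coeff_zero, coeff_mul_monomial', mul_one] at hcoeff
    rw [Finset.sum_eq_single_of_mem β hβ.prop, if_pos le_rfl, tsub_self] at hcoeff
    · refine (mem_support_iff.mp hβ.prop) (hf.eq_zero_of_aeval_eq_zero _ ?_)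
      change constantCoeff (aeval f (coeff β q)) = 0 at hcoeff
      rw [map_aeval] at hcoeff
      have hmap : (constantCoeff.comp (algebraMap R (MvPolynomial σ L))) = algebraMap R L := by
        ext r
        exact constantCoeff_C σ (algebraMap R L r)
      rwa [hmap] at hcoeff
    · intro γ hγ hne
      rw [if_neg]
      exact fun hle => hne (le_antisymm hle (hβ.le_of_le hγ hle))
  rw [algebraicIndependent_iff]
  intro p hp
  have h := key (sumAlgEquiv R σ ι p) ?_
  · simpa using h
  · have hcomp : (eval₂Hom (aeval f : MvPolynomial ι R →ₐ[R] MvPolynomial σ L).toRingHom X).comp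
        (sumAlgEquiv R σ ι).toAlgHom.toRingHom = (aeval (Sum.elim X f)).toRingHom := by
      refine ringHom_ext (fun a => ?_) ?_
      · change eval₂ _ X (sumAlgEquiv R σ ι (C a)) = aeval (Sum.elim X f) (C a)
        rw [sumAlgEquiv_C_inl, eval₂_C, algHom_C]
        exact algHom_C _ a
      · rintro (i | i) <;> simp
    rw [← hp]
    exact DFunLike.congr_fun hcomp p

/-- Translating an algebraically independent family by scalars preserves independence. -/
theorem AlgebraicIndependent.sub_algebraMap {R A ι : Type*} [Field R] [Field A] [Algebra R A]
    {x : ι → A} (hx : AlgebraicIndependent R x) (c : ι → R) :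
    AlgebraicIndependent R (fun i => x i - algebraMap R A (c i)) := by
  have := hx.polynomial_aeval_of_transcendental (f := fun i => Polynomial.X - Polynomial.C (c i))
    fun i => by
      have := (Polynomial.transcendental_X R).aeval (Polynomial.X - Polynomial.C (c i))
        (by simp)
      simpa using this
  simpa using this

/-- In a family `Sum.elim x y` with `y` a sequence, if `x` is algebraically independent but the
whole is not, then some `y r` is algebraic over `x` and the earlier terms of `y`. -/
theorem AlgebraicIndependent.exists_isAlgebraic_of_not_sumElim {R A ι : Type*} [Field R] [Field A]
    [Algebra R A] {x : ι → A} (hx : AlgebraicIndependent R x) {y : ℕ → A}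
    (hxy : ¬ AlgebraicIndependent R (Sum.elim x y)) :
    ∃ r, IsAlgebraic (Algebra.adjoin R (Set.range x ∪ y '' Set.Iio r)) (y r) := by
  by_contra! h
  apply hxy
  have hind : ∀ r : ℕ, AlgebraicIndepOn R (Sum.elim x y)
      (Set.range Sum.inl ∪ Sum.inr '' Set.Iio r) := by
    intro r
    induction r with
    | zero =>
      have h0 : (Set.range Sum.inl ∪ Sum.inr '' Set.Iio 0 : Set (ι ⊕ ℕ)) = Set.range Sum.inl := by
        simp
      rw [h0]
      exact (algebraicIndependent_equiv' (Equiv.ofInjective _ Sum.inl_injective) rfl).mp hx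
    | succ r ih =>
      have h1 : (Set.range Sum.inl ∪ Sum.inr '' Set.Iio (r + 1) : Set (ι ⊕ ℕ)) =
          insert (Sum.inr r) (Set.range Sum.inl ∪ Sum.inr '' Set.Iio r) := by
        ext (a | a) <;> simp [Nat.le_iff_lt_or_eq, or_comm]
      rw [h1]
      refine ih.insert ?_
      have h2 : Sum.elim x y '' (Set.range Sum.inl ∪ Sum.inr '' Set.Iio r) =
          Set.range x ∪ y '' Set.Iio r := by
        rw [Set.image_union, Set.image_image, ← Set.range_comp]
        rfl
      rw [h2]
      exact h r
  refine algebraicIndependent_of_finite_type fun t ht => ?_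
  have hev : ∀ i ∈ t, ∀ᶠ r in Filter.atTop,
      i ∈ (Set.range Sum.inl ∪ Sum.inr '' Set.Iio r : Set (ι ⊕ ℕ)) := by
    rintro (i | k) -
    · simp
    · filter_upwards [Filter.eventually_gt_atTop k] with r hr
      simpa using hr
  obtain ⟨r, hr⟩ := ((Filter.eventually_all_finite ht).mpr hev).exists
  exact (hind r).mono hr

/-- The algebraic closure in `E` of the field generated by `S` over `K`, as a subfield. -/
def algClosureAdjoin {E : Type*} [Field E] (K : Subfield E) (S : Set E) : Subfield E :=
  (algebraicClosure (IntermediateField.adjoin K S) E).toSubfield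

section AlgClosureAdjoin

variable {E : Type*} [Field E] {K : Subfield E} {S S' : Set E}

theorem mem_algClosureAdjoin_iff {x : E} :
    x ∈ algClosureAdjoin K S ↔ IsAlgebraic (Algebra.adjoin K S) x := by
  rw [← IntermediateField.isAlgebraic_adjoin_iff]
  exact mem_algebraicClosure_iff

theorem coe_algClosureAdjoin :
    (algClosureAdjoin K S : Set E) = (AlgebraicIndependent.matroid K E).closure S := by
  ext x
  rw [AlgebraicIndependent.matroid_closure_eq]
  exact mem_algClosureAdjoin_iff

theorem algClosureAdjoin_mono (h : S ⊆ S') : algClosureAdjoin K S ≤ algClosureAdjoin K S' := by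
  rw [← SetLike.coe_subset_coe, coe_algClosureAdjoin, coe_algClosureAdjoin]
  exact Matroid.closure_mono _ h

theorem subset_algClosureAdjoin : S ⊆ algClosureAdjoin K S := by
  rw [coe_algClosureAdjoin]
  exact Matroid.subset_closure _ _ (Set.subset_univ _)

theorem le_algClosureAdjoin : K ≤ algClosureAdjoin K S := fun x hx =>
  mem_algClosureAdjoin_iff.mpr (isAlgebraic_algebraMap
    (⟨x, Subalgebra.algebraMap_mem _ (⟨x, hx⟩ : K)⟩ : Algebra.adjoin K S))

theorem adjoin_le_algClosureAdjoin :
    (IntermediateField.adjoin K S).toSubfield ≤ algClosureAdjoin K S := fun x hx =>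
  mem_algebraicClosure_iff.mpr (isAlgebraic_algebraMap
    (⟨x, hx⟩ : IntermediateField.adjoin K S))

/-- An element algebraic over an increasing union of generating sets is algebraic over one of
them. -/
theorem eventually_mem_algClosureAdjoin_of_iUnion {B : ℕ → Set E} (hB : Monotone B) {x : E}
    (hx : x ∈ algClosureAdjoin K (⋃ N, B N)) :
    ∀ᶠ N in Filter.atTop, x ∈ algClosureAdjoin K (B N) := by
  rw [← SetLike.mem_coe, coe_algClosureAdjoin] at hx
  obtain ⟨I, hIB, hI, -, hxI⟩ := Matroid.exists_mem_finite_closure_of_mem_closure hx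
  have hev : ∀ i ∈ I, ∀ᶠ N in Filter.atTop, i ∈ B N := by
    intro i hi
    obtain ⟨N, hN⟩ := Set.mem_iUnion.mp (hIB hi)
    filter_upwards [Filter.eventually_ge_atTop N] with M hM using hB hM hN
  filter_upwards [(Filter.eventually_all_finite hI).mpr hev] with N hN
  rw [← SetLike.mem_coe, coe_algClosureAdjoin]
  exact Matroid.closure_mono _ hN hxI

/-- An algebraically independent family of elements algebraic over `K(S)` with `S` indexed by a
finite type is no larger than that type. -/
theorem AlgebraicIndependent.card_le_of_mem_algClosureAdjoin {ι κ : Type*} [Fintype ι] [Fintype κ]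
    {x : ι → E} (hx : AlgebraicIndependent K x) {b : κ → E}
    (hmem : ∀ i, x i ∈ algClosureAdjoin K (Set.range b)) : Fintype.card ι ≤ Fintype.card κ := by
  have hI : (AlgebraicIndependent.matroid K E).Indep (Set.range x) := hx.to_subtype_range
  have h1 := hI.encard_le_eRk_of_subset (X := (AlgebraicIndependent.matroid K E).closure
    (Set.range b)) (by
      rw [← coe_algClosureAdjoin]
      rintro _ ⟨i, rfl⟩
      exact hmem i)
  rw [Matroid.eRk_closure_eq] at h1
  have h2 := h1.trans (Matroid.eRk_le_encard _ _)
  rw [← Set.image_univ, ← Set.image_univ, hx.injective.injOn.encard_image] at h2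
  have h3 := h2.trans (Set.encard_image_le b _)
  simpa using h3

variable [CharZero E] (D : Derivation ℤ E E)

theorem derivation_mem_algClosureAdjoin (hK : ∀ x ∈ K, D x ∈ K)
    (hSS' : ∀ x ∈ S, x ∈ algClosureAdjoin K S') (hS : ∀ x ∈ S, D x ∈ algClosureAdjoin K S')
    {x : E} (hx : x ∈ algClosureAdjoin K S) : D x ∈ algClosureAdjoin K S' := by
  have hsub : algClosureAdjoin K S ≤ algClosureAdjoin K S' := by
    rw [← SetLike.coe_subset_coe, coe_algClosureAdjoin, coe_algClosureAdjoin]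
    refine Matroid.closure_subset_closure_of_subset_closure ?_
    rw [← coe_algClosureAdjoin]
    exact hSS'
  have hN : ∀ y ∈ IntermediateField.adjoin K S, D y ∈ algClosureAdjoin K S' := by
    intro y hy
    induction hy using IntermediateField.adjoin_induction with
    | mem y hy => exact hS y hy
    | algebraMap y => exact le_algClosureAdjoin (hK _ y.2)
    | add y z _ _ hy hz => rw [map_add]; exact add_mem hy hz
    | inv y hy' hy =>
      rw [D.leibniz_inv]
      refine mul_mem (neg_mem (pow_mem (inv_mem (hsub ?_)) 2)) hy
      exact adjoin_le_algClosureAdjoin hy'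
    | mul y z hy' hz' hy hz =>
      rw [D.leibniz]
      exact add_mem (mul_mem (hsub (adjoin_le_algClosureAdjoin hy')) hz)
        (mul_mem (hsub (adjoin_le_algClosureAdjoin hz')) hy)
  have hx' : IsAlgebraic (IntermediateField.adjoin K S) x := mem_algebraicClosure_iff.mp hx
  set p := minpoly (IntermediateField.adjoin K S) x
  have hchain : ∀ q : Polynomial (IntermediateField.adjoin K S),
      D (Polynomial.aeval x q) - Polynomial.aeval x q.derivative * D x ∈ algClosureAdjoin K S' := by
    intro q
    induction q using Polynomial.induction_on' with
    | add q r hq hr =>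
      have := add_mem hq hr
      convert this using 1
      simp only [map_add]
      ring
    | monomial n a =>
      have := mul_mem (pow_mem (hsub hx) n) (hN a a.2)
      convert this using 1
      simp [Polynomial.aeval_monomial, Polynomial.derivative_monomial, D.leibniz, D.leibniz_pow]
      ring
  have haeval : ∀ q : Polynomial (IntermediateField.adjoin K S),
      Polynomial.aeval x q ∈ algClosureAdjoin K S' := by
    intro q
    rw [Polynomial.aeval_eq_sum_range]
    refine sum_mem fun i _ => ?_
    rw [Algebra.smul_def]
    exact mul_mem (hsub (adjoin_le_algClosureAdjoin (q.coeff i).2)) (pow_mem (hsub hx) i)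
  have hne : Polynomial.aeval x p.derivative ≠ 0 :=
    (minpoly.irreducible hx'.isIntegral).separable.aeval_derivative_ne_zero (minpoly.aeval _ _)
  have h0 := hchain p
  rw [minpoly.aeval, map_zero, zero_sub, neg_mem_iff] at h0
  have := mul_mem (inv_mem (haeval p.derivative)) h0
  rwa [inv_mul_cancel_left₀ hne] at this

end AlgClosureAdjoin

section DiffAdjoin

variable {E : Type*} [Field E] (D : Derivation ℤ E E) {F K : Subfield E} {S : Set E}

theorem le_diffAdjoin (δ : E → E) : F ≤ diffAdjoin δ F S := fun _ hx =>
  Subfield.subset_closure (Or.inl hx)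

theorem iterate_mem_diffAdjoin (δ : E → E) {x : E} (hx : x ∈ S) (k : ℕ) :
    δ^[k] x ∈ diffAdjoin δ F S :=
  Subfield.subset_closure (Or.inr ⟨x, hx, k, rfl⟩)

theorem subset_diffAdjoin (δ : E → E) : S ⊆ diffAdjoin δ F S := fun _ hx =>
  iterate_mem_diffAdjoin δ hx 0

theorem derivation_mem_diffAdjoin (hF : ∀ x ∈ F, D x ∈ F) {x : E} (hx : x ∈ diffAdjoin D F S) :
    D x ∈ diffAdjoin D F S := by
  induction hx using Subfield.closure_induction with
  | mem x hx =>
    rcases hx with hx | ⟨s, hs, k, rfl⟩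
    · exact le_diffAdjoin D (hF x hx)
    · rw [← Function.iterate_succ_apply' D]
      exact iterate_mem_diffAdjoin D hs (k + 1)
  | one => simp
  | add x y _ _ hx hy => rw [map_add]; exact add_mem hx hy
  | neg x _ hx => rw [map_neg]; exact neg_mem hx
  | inv x hx' hx =>
    rw [D.leibniz_inv]
    exact mul_mem (neg_mem (pow_mem (inv_mem hx') 2)) hx
  | mul x y hx' hy' hx hy =>
    rw [D.leibniz]
    exact add_mem (mul_mem hx' hy) (mul_mem hy' hx)

theorem monValue_mem_diffAdjoin (δ : E → E) {n : ℕ} (s m : ℕ) (ξ : Fin n → E) (α : GenMon n s m) :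
    monValue δ s m ξ α ∈ diffAdjoin δ F (Set.range ξ) :=
  prod_mem fun p _ => pow_mem (iterate_mem_diffAdjoin δ (Set.mem_range_self p.1) _) _

/-- If every element of `K` and of the family `ξ` is eventually in an increasing sequence of
subfields `A` with `D (A N) ⊆ A (N + 1)`, then so is every element of `K⟨ξ⟩`. -/
theorem eventually_mem_of_mem_diffAdjoin {A : ℕ → Subfield E} (hA : Monotone A)
    (hK : ∀ N, K ≤ A N) (hS : ∀ x ∈ S, ∀ᶠ N in Filter.atTop, x ∈ A N)
    (hD : ∀ᶠ N in Filter.atTop, ∀ x ∈ A N, D x ∈ A (N + 1)) {x : E} (hx : x ∈ diffAdjoin D K S) :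
    ∀ᶠ N in Filter.atTop, x ∈ A N := by
  induction hx using Subfield.closure_induction with
  | mem x hx =>
    rcases hx with hx | ⟨s, hs, k, rfl⟩
    · exact Filter.Eventually.of_forall fun N => hK N hx
    · induction k with
      | zero => exact hS s hs
      | succ k ih =>
        rw [Function.iterate_succ_apply']
        obtain ⟨N, h1, h2⟩ := (ih.and hD).exists
        filter_upwards [Filter.eventually_ge_atTop (N + 1)] with M hM using hA hM (h2 _ h1)
  | one => simp
  | add x y _ _ hx hy => filter_upwards [hx, hy] with N hx hy using add_mem hx hy
  | neg x _ hx => filter_upwards [hx] with N hx using neg_mem hx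
  | inv x _ hx => filter_upwards [hx] with N hx using inv_mem hx
  | mul x y _ _ hx hy => filter_upwards [hx, hy] with N hx hy using mul_mem hx hy

end DiffAdjoin

/-- Differential independence over a larger subfield implies it over a smaller one. -/
theorem DiffIndep.of_le {E ι : Type*} [Field E] {δ : E → E} {F K : Subfield E} (hFK : F ≤ K)
    {a : ι → E} (h : DiffIndep δ K a) : DiffIndep δ F a :=
  AlgebraicIndependent.of_ringHom_of_comp_eq (Subfield.inclusion hFK) (RingHom.id E) h
    (Subfield.inclusion hFK).injective rfl

theorem DiffIndep.comp {E ι κ : Type*} [Field E] {δ : E → E} {K : Subfield E} {a : ι → E}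
    (h : DiffIndep δ K a) {g : κ → ι} (hg : Function.Injective g) :
    DiffIndep δ K (fun i => a (g i)) :=
  AlgebraicIndependent.comp h (Prod.map g id) (hg.prodMap Function.injective_id)

theorem DiffIndep.of_isEmpty {E ι : Type*} [Field E] [IsEmpty ι] (δ : E → E) (K : Subfield E)
    (a : ι → E) : DiffIndep δ K a :=
  algebraicIndependent_empty_type

/-- If adjoining an element to a differentially independent finite subfamily destroys
independence, some derivative of that element is algebraic over the derivatives of the subfamily
and its own earlier derivatives. -/
theorem DiffIndep.exists_iterate_mem_algClosureAdjoin {E κ : Type*} [Field E] [DecidableEq κ]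
    {δ : E → E} {K : Subfield E} {ξ : κ → E} {T : Finset κ} (hT : DiffIndep δ K (fun i : T => ξ i))
    {j : κ} (hj : ¬ DiffIndep δ K (fun i : ↥(insert j T) => ξ i)) :
    ∃ r, δ^[r] (ξ j) ∈ algClosureAdjoin K
      (Set.range (fun p : T × ℕ => δ^[p.2] (ξ p.1)) ∪ (fun k => δ^[k] (ξ j)) '' Set.Iio r) := by
  simp_rw [mem_algClosureAdjoin_iff]
  refine AlgebraicIndependent.exists_isAlgebraic_of_not_sumElim hT fun h => hj ?_
  let g : ↥(insert j T) × ℕ → (T × ℕ) ⊕ ℕ := fun p =>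
    if hp : p.1.1 ∈ T then Sum.inl (⟨p.1.1, hp⟩, p.2) else Sum.inr p.2
  have hmem : ∀ i : ↥(insert j T), i.1 ∉ T → i.1 = j := fun i hi =>
    (Finset.mem_insert.mp i.2).resolve_right hi
  have hg : Function.Injective g := by
    rintro ⟨a, k⟩ ⟨b, l⟩ hab
    by_cases ha : a.1 ∈ T <;> by_cases hb : b.1 ∈ T <;> simp [g, ha, hb] at hab
    · exact Prod.ext hab.1 hab.2
    · exact Prod.ext (Subtype.ext ((hmem a ha).trans (hmem b hb).symm)) hab
  have := h.comp g hg
  unfold DiffIndep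
  convert! this using 1
  ext ⟨a, k⟩
  by_cases ha : a.1 ∈ T
  · simp [g, ha]
  · rw [Function.comp_apply, show g (a, k) = Sum.inr k from dif_neg ha]
    simp [hmem a ha]

/-- If all differentially independent subfamilies of `ξ` have at most `d` members, then any `d + 1`
elements of `K⟨ξ⟩` are differentially dependent over `K`. -/
theorem not_diffIndep_of_mem_diffAdjoin {E : Type*} [Field E] [CharZero E] (D : Derivation ℤ E E)
    {K : Subfield E} (hK : ∀ x ∈ K, D x ∈ K) {n d : ℕ} {ξ : Fin n → E}
    (hcard : ∀ S : Finset (Fin n), DiffIndep D K (fun i : S => ξ i) → S.card ≤ d)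
    {ζ : Fin (d + 1) → E} (hζ : ∀ i, ζ i ∈ diffAdjoin D K (Set.range ξ)) : ¬ DiffIndep D K ζ := by
  classical
  obtain ⟨T, hT⟩ := (Set.toFinite
    {S : Finset (Fin n) | DiffIndep D K (fun i : S => ξ i)}).exists_maximal ⟨∅,
      show DiffIndep D K (fun i : (∅ : Finset (Fin n)) => ξ i) from .of_isEmpty _ _ _⟩
  have hex : ∀ j : Fin n, j ∉ T → ∃ r, D^[r] (ξ j) ∈ algClosureAdjoin K
      (Set.range (fun p : T × ℕ => D^[p.2] (ξ p.1)) ∪ (fun k => D^[k] (ξ j)) '' Set.Iio r) :=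
    fun j hj => hT.prop.exists_iterate_mem_algClosureAdjoin fun h =>
      hj (hT.le_of_ge h (Finset.subset_insert j T) (Finset.mem_insert_self j T))
  choose! r hr using hex
  let b : (N : ℕ) → (T × Fin (N + 1)) ⊕ (Σ j : Fin n, Fin (r j)) → E := fun N =>
    Sum.elim (fun p => D^[p.2] (ξ p.1)) (fun p => D^[p.2] (ξ p.1))
  let B : ℕ → Set E := fun N => Set.range (b N)
  have hBl : ∀ {N k : ℕ} {t : Fin n}, t ∈ T → k ≤ N → D^[k] (ξ t) ∈ B N := fun {N k t} ht hk =>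
    ⟨Sum.inl (⟨t, ht⟩, ⟨k, Nat.lt_succ_of_le hk⟩), rfl⟩
  have hBr : ∀ {N k : ℕ} {j : Fin n}, k < r j → D^[k] (ξ j) ∈ B N := fun {N k j} hk =>
    ⟨Sum.inr ⟨j, ⟨k, hk⟩⟩, rfl⟩
  have hB : Monotone B := by
    rintro N M hNM _ ⟨⟨t, k⟩ | ⟨j, k⟩, rfl⟩
    · exact hBl t.2 ((Nat.le_of_lt_succ k.2).trans hNM)
    · exact hBr k.2
  have hA : Monotone fun N => algClosureAdjoin K (B N) := fun N M h => algClosureAdjoin_mono (hB h)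
  have hr' : ∀ᶠ N in Filter.atTop, ∀ j, j ∉ T → D^[r j] (ξ j) ∈ algClosureAdjoin K (B N) := by
    rw [Filter.eventually_all]
    intro j
    by_cases hj : j ∈ T
    · simp [hj]
    · have hsub : Set.range (fun p : T × ℕ => D^[p.2] (ξ p.1)) ∪
          (fun k => D^[k] (ξ j)) '' Set.Iio (r j) ⊆ ⋃ N, B N := by
        rintro _ (⟨⟨t, k⟩, rfl⟩ | ⟨k, hk, rfl⟩)
        · exact Set.mem_iUnion.mpr ⟨k, hBl t.2 le_rfl⟩
        · exact Set.mem_iUnion.mpr ⟨0, hBr hk⟩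
      filter_upwards [eventually_mem_algClosureAdjoin_of_iUnion hB
        (algClosureAdjoin_mono hsub (hr j hj))] with N hN _ using hN
  have hD : ∀ᶠ N in Filter.atTop, ∀ x ∈ algClosureAdjoin K (B N),
      D x ∈ algClosureAdjoin K (B (N + 1)) := by
    filter_upwards [hr', Filter.eventually_all.mpr fun j => Filter.eventually_ge_atTop (r j)]
      with N hN hrN x hx
    refine derivation_mem_algClosureAdjoin D hK
      (fun y hy => subset_algClosureAdjoin (hB N.le_succ hy)) ?_ hx
    rintro _ ⟨⟨t, k⟩ | ⟨j, k⟩, rfl⟩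
    · change D (D^[k] (ξ t)) ∈ _
      rw [← Function.iterate_succ_apply' D]
      exact subset_algClosureAdjoin (hBl t.2 k.2)
    · change D (D^[k] (ξ j)) ∈ _
      rw [← Function.iterate_succ_apply' D]
      rcases (Nat.succ_le_of_lt k.2).lt_or_eq with hk | hk
      · exact subset_algClosureAdjoin (hBr hk)
      · by_cases hj : j ∈ T
        · exact subset_algClosureAdjoin (hBl hj (hk.le.trans ((hrN j).trans N.le_succ)))
        · rw [hk]
          exact hA N.le_succ (hN j hj)
  have hξ : ∀ x ∈ Set.range ξ, ∀ᶠ N in Filter.atTop, x ∈ algClosureAdjoin K (B N) := by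
    rintro _ ⟨j, rfl⟩
    filter_upwards [hr'] with N hN
    by_cases hj : j ∈ T
    · exact subset_algClosureAdjoin (hBl (k := 0) hj N.zero_le)
    · rcases (r j).eq_zero_or_pos with h0 | h0
      · simpa [h0] using hN j hj
      · exact subset_algClosureAdjoin (hBr (k := 0) h0)
  have hζ' : ∀ᶠ N in Filter.atTop, ∀ i, ζ i ∈ algClosureAdjoin K (B N) :=
    Filter.eventually_all.mpr fun i => eventually_mem_of_mem_diffAdjoin D hA
      (fun N => le_algClosureAdjoin) hξ hD (hζ i)
  obtain ⟨h, hh⟩ := Filter.eventually_atTop.mp (hζ'.and hD)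
  have hiter : ∀ (k : ℕ) (i), D^[k] (ζ i) ∈ algClosureAdjoin K (B (h + k)) := by
    intro k i
    induction k with
    | zero => exact (hh h le_rfl).1 i
    | succ k ih =>
      rw [Function.iterate_succ_apply']
      exact (hh (h + k) (Nat.le_add_right h k)).2 _ ih
  intro hind
  set N := d * h + ∑ j, r j with hN
  have hle := AlgebraicIndependent.card_le_of_mem_algClosureAdjoin
    (AlgebraicIndependent.comp hind (Prod.map id Fin.val : Fin (d + 1) × Fin (N + 1) → _)
      (Function.injective_id.prodMap Fin.val_injective)) (b := b (h + N))
    fun p => hA (Nat.add_le_add_left (Nat.le_of_lt_succ p.2.2) h) (hiter p.2 p.1)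
  simp only [Fintype.card_prod, Fintype.card_sum, Fintype.card_sigma, Fintype.card_fin,
    Fintype.card_coe] at hle
  have hTd := Nat.mul_le_mul_right (h + N + 1) (hcard T hT.prop)
  nlinarith

section Specialization

variable {E : Type*} [Field E] (D : Derivation ℤ E E)

/-- Independence over `F` of `a` jointly with `v` gives independence of `a` over any subfield of
`F(v)`. -/
theorem AlgebraicIndependent.of_sumElim_of_le {F K : Subfield E} {σ ι : Type*} {v : σ → E}
    {a : ι → E} (h : AlgebraicIndependent F (Sum.elim v a))
    (hK : K ≤ (IntermediateField.adjoin F (Set.range v)).toSubfield) :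
    AlgebraicIndependent K a := by
  have h' : AlgebraicIndependent F (Sum.elim a v) := by
    convert h.comp (Equiv.sumComm ι σ) (Equiv.injective _) using 1
    ext (i | i) <;> rfl
  have := IntermediateField.algebraicIndependent_adjoin_iff.mpr
    (AlgebraicIndependent.sumElim_iff.mp h').2
  exact AlgebraicIndependent.of_ringHom_of_comp_eq (Subfield.inclusion hK) (RingHom.id E) this
    (Subfield.inclusion hK).injective rfl

/-- Derivatives of `u * x`, with `x` in a differential subfield `L`, as polynomials over `L` in the
translates `δᵏ u - c k`, together with their constant terms. -/
theorem exists_mvPolynomial_iterate_mul {L : Subfield E} (hL : ∀ x ∈ L, D x ∈ L) {κ : Type*}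
    (u : κ → E) (c : κ → ℕ → L) (i : κ) (k l : ℕ) {x : E} (hx : x ∈ L)
    (hc : ∀ l, c i (l + 1) = 0) :
    ∃ f : MvPolynomial (κ × ℕ) L,
      MvPolynomial.aeval (fun p : κ × ℕ => D^[p.2] (u p.1) - algebraMap L E (c p.1 p.2)) f =
        D^[k] (D^[l] (u i) * x) ∧
      algebraMap L E (MvPolynomial.constantCoeff f) = c i l * D^[k] x := by
  induction k generalizing l x with
  | zero =>
    refine ⟨(MvPolynomial.X (i, l) + MvPolynomial.C (c i l)) * MvPolynomial.C ⟨x, hx⟩, ?_, ?_⟩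
    · rw [map_mul, map_add, MvPolynomial.aeval_X, MvPolynomial.aeval_C, MvPolynomial.aeval_C,
        sub_add_cancel]
      rfl
    · rw [map_mul, map_mul, map_add, MvPolynomial.constantCoeff_X, MvPolynomial.constantCoeff_C,
        MvPolynomial.constantCoeff_C, zero_add]
      rfl
  | succ k ih =>
    obtain ⟨f, hf, hf'⟩ := ih l (hL x hx)
    obtain ⟨g, hg, hg'⟩ := ih (l + 1) hx
    refine ⟨f + g, ?_, ?_⟩
    · rw [map_add, hf, hg, ← iterate_map_add, Function.iterate_succ_apply D k (D^[l] (u i) * x),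
        D.leibniz, ← Function.iterate_succ_apply' D l]
      simp [mul_comm]
    · rw [map_add, map_add, hf', hg', hc]
      simp

/-- The exponent vector of the linear monomial `ξ_t`. -/
def GenMon.single {n : ℕ} (s m : ℕ) (hm : 1 ≤ m) (t : Fin n) : GenMon n s m :=
  ⟨Pi.single (t, 0) ⟨1, Nat.lt_succ_of_le hm⟩, by
    have : ∑ p : Fin n × Fin (s + 1),
        ((Pi.single (t, 0) ⟨1, Nat.lt_succ_of_le hm⟩ : Fin n × Fin (s + 1) → Fin (m + 1)) p : ℕ) =
          1 := by
      rw [Finset.sum_eq_single (t, 0)]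
      · simp
      · intro p _ hp
        simp [hp]
      · simp
    rw [this]
    exact ⟨le_rfl, hm⟩⟩

theorem monValue_single (δ : E → E) {n : ℕ} (s m : ℕ) (hm : 1 ≤ m) (ξ : Fin n → E) (t : Fin n) :
    monValue δ s m ξ (GenMon.single s m hm t) = ξ t := by
  unfold monValue GenMon.single
  rw [Finset.prod_eq_single (t, 0)]
  · simp
  · intro p _ hp
    simp [hp]
  · simp

/-- Generic linear combinations `∑ α, u i α * y i α` are differentially independent over `F⟨u⟩`
when one specialization `y i (e i)` of them is differentially independent over `F`. -/
theorem DiffIndep.of_specialization {F L : Subfield E} (hFL : F ≤ L) (hL : ∀ x ∈ L, D x ∈ L)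
    {ι : Type*} {M : ι → Type*} [∀ i, Fintype (M i)] {u : (i : ι) → M i → E}
    (hu : DiffIndep D L (fun q : Σ i, M i => u q.1 q.2)) {y : (i : ι) → M i → E}
    (hy : ∀ i α, y i α ∈ L) {κ : Type*} (j : κ → ι) (e : (i : κ) → M (j i))
    (hj : Function.Injective j)
    (hind : DiffIndep D F (fun i => y (j i) (e i))) :
    DiffIndep D (diffAdjoin D F {x | ∃ i α, u i α = x})
      (fun i => -∑ α, u (j i) α * y (j i) α) := by
  classical
  let : Algebra F L := (Subfield.inclusion hFL).toAlgebra
  have : IsScalarTower F L E := .of_algebraMap_eq fun _ => rfl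
  let c : (Σ i, M i) → ℕ → L := fun q k =>
    if k = 0 ∧ ∃ i, (⟨j i, e i⟩ : Σ i, M i) = q then -1 else 0
  let v : (Σ i, M i) × ℕ → E := fun p => D^[p.2] (u p.1.1 p.1.2) - algebraMap L E (c p.1 p.2)
  have hv : AlgebraicIndependent L v :=
    AlgebraicIndependent.sub_algebraMap hu fun p => c p.1 p.2
  have hpoly : ∀ p : κ × ℕ, ∃ f : MvPolynomial ((Σ i, M i) × ℕ) L,
      MvPolynomial.aeval v f = D^[p.2] (-∑ α, u (j p.1) α * y (j p.1) α) ∧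
      algebraMap L E (MvPolynomial.constantCoeff f) = D^[p.2] (y (j p.1) (e p.1)) := by
    rintro ⟨i, k⟩
    have hα := fun α => exists_mvPolynomial_iterate_mul D hL (fun q : Σ i, M i => u q.1 q.2) c
      ⟨j i, α⟩ k 0 (hy (j i) α) (by simp [c])
    choose f hf hf' using hα
    have hsum : ∀ g : M (j i) → E, D^[k] (-∑ α, g α) = -∑ α, D^[k] (g α) := fun g => by
      simp_rw [← Derivation.coeFn_coe, ← Module.End.pow_apply, map_neg, map_sum]
    refine ⟨-∑ α, f α, ?_, ?_⟩
    · rw [map_neg, map_sum, hsum]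
      exact congrArg _ (Finset.sum_congr rfl fun α _ => hf α)
    · simp_rw [map_neg, map_sum, hf']
      rw [Finset.sum_eq_single (e i)]
      · have hc : c ⟨j i, e i⟩ 0 = -1 := if_pos ⟨rfl, i, rfl⟩
        simp [hc]
      · intro α _ hα
        have : ¬ ∃ i', (⟨j i', e i'⟩ : Σ i, M i) = ⟨j i, α⟩ := by
          rintro ⟨i', h⟩
          obtain rfl := hj (congrArg Sigma.fst h)
          exact hα (eq_of_heq (Sigma.mk.inj h).2).symm
        have hc : c ⟨j i, α⟩ 0 = 0 := if_neg fun h => this h.2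
        simp [hc]
      · simp
  choose f hf hf' using hpoly
  have hconst : AlgebraicIndependent F (fun p => MvPolynomial.constantCoeff (f p)) := by
    refine AlgebraicIndependent.of_comp (IsScalarTower.toAlgHom F L E) ?_
    have hcomp : IsScalarTower.toAlgHom F L E ∘ (fun p => MvPolynomial.constantCoeff (f p)) =
        fun p => D^[p.2] (y (j p.1) (e p.1)) := funext hf'
    rw [hcomp]
    exact hind
  have hjoint := (MvPolynomial.algebraicIndependent_sumElim_X_of_constantCoeff f hconst).map'
    (f := (MvPolynomial.aeval v : MvPolynomial _ L →ₐ[L] E).restrictScalars F) hv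
  have hcomp : ((MvPolynomial.aeval v : MvPolynomial _ L →ₐ[L] E).restrictScalars F) ∘
      Sum.elim MvPolynomial.X f =
        Sum.elim v (fun p => D^[p.2] (-∑ α, u (j p.1) α * y (j p.1) α)) := by
    ext (p | p)
    · simp
    · simpa using hf p
  rw [hcomp] at hjoint
  refine hjoint.of_sumElim_of_le (Subfield.closure_le.mpr ?_)
  rintro x (hx | ⟨_, ⟨i, α, rfl⟩, k, rfl⟩)
  · exact (IntermediateField.adjoin F (Set.range v)).algebraMap_mem ⟨x, hx⟩
  · have hc : algebraMap L E (c ⟨i, α⟩ k) ∈ IntermediateField.adjoin F (Set.range v) := by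
      by_cases h : k = 0 ∧ ∃ i', (⟨j i', e i'⟩ : Σ i, M i) = ⟨i, α⟩
      · simp only [c, if_pos h, map_neg, map_one]
        exact neg_mem (one_mem _)
      · simp only [c, if_neg h, map_zero]
        exact zero_mem _
    have h := add_mem (IntermediateField.subset_adjoin F (Set.range v) ⟨(⟨i, α⟩, k), rfl⟩) hc
    rwa [sub_add_cancel] at h

end Specialization

/-- **Differential transcendence degrees for the generalized Chow form.**
Let `ξ` have differential transcendence degree `d` over `F`, let the combined family
`(u_{iα})` of coefficients of `d+1` generic differential polynomials of orders `sᵢ` and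
degrees `mᵢ` be differentially independent over `F⟨ξ₁,…,ξₙ⟩`, set
`ζᵢ = −∑_{α} u_{iα} ξ^α` and `K = F⟨u_{iα}⟩`.  Then `ζ₀,…,ζ_d` are differentially
dependent over `K`, and if `d > 0`, then for every `i` the family `(ζⱼ)_{j≠i}` is
differentially independent over `K`. -/
theorem generalized_chow_coordinates_transcendence
    {E : Type*} [Field E] [CharZero E] (δ : E → E)
    (hδadd : ∀ a b : E, δ (a + b) = δ a + δ b)
    (hδmul : ∀ a b : E, δ (a * b) = a * δ b + δ a * b)
    (F : Subfield E) (hF : ∀ x ∈ F, δ x ∈ F)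
    (n d : ℕ) (ξ : Fin n → E)
    (T : Finset (Fin n)) (hTcard : T.card = d)
    (hTindep : DiffIndep δ F (fun i : T => ξ i))
    (hdep : ∀ S : Finset (Fin n), S.card = d + 1 → ¬ DiffIndep δ F (fun i : S => ξ i))
    (s m : Fin (d + 1) → ℕ) (hm : ∀ i, 1 ≤ m i)
    (u : (i : Fin (d + 1)) → GenMon n (s i) (m i) → E)
    (hu : DiffIndep δ (diffAdjoin δ F (Set.range ξ))
      (fun q : Σ i : Fin (d + 1), GenMon n (s i) (m i) => u q.1 q.2))
    (ζ : Fin (d + 1) → E)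
    (hζ : ∀ i, ζ i = -∑ α : GenMon n (s i) (m i), u i α * monValue δ (s i) (m i) ξ α) :
    ¬ DiffIndep δ (diffAdjoin δ F {x | ∃ i α, u i α = x}) ζ ∧
      (0 < d → ∀ i : Fin (d + 1),
        DiffIndep δ (diffAdjoin δ F {x | ∃ i α, u i α = x})
          (fun j : {j : Fin (d + 1) // j ≠ i} => ζ j)) := by
  classical
  obtain ⟨D, rfl⟩ : ∃ D : Derivation ℤ E E, ⇑D = δ :=
    ⟨Derivation.mk' (AddMonoidHom.mk' δ hδadd).toIntLinearMap fun a b => by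
      simp [hδmul, mul_comm], rfl⟩
  have hζmem : ∀ i, ζ i ∈ diffAdjoin D (diffAdjoin D F {x | ∃ i α, u i α = x}) (Set.range ξ) := by
    intro i
    rw [hζ i]
    exact neg_mem (sum_mem fun α _ => mul_mem
      (le_diffAdjoin D (subset_diffAdjoin D ⟨i, α, rfl⟩)) (monValue_mem_diffAdjoin D _ _ ξ α))
  refine ⟨not_diffIndep_of_mem_diffAdjoin D (fun x hx => derivation_mem_diffAdjoin D hF hx)
    (fun S hS => ?_) hζmem, fun _ i => ?_⟩
  · by_contra! hlt
    obtain ⟨S', hS'S, hS'⟩ := Finset.exists_subset_card_eq (Nat.succ_le_of_lt hlt)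
    refine hdep S' hS' (DiffIndep.of_le (K := diffAdjoin D F {x | ∃ i α, u i α = x})
      (le_diffAdjoin D) ?_)
    exact hS.comp (g := Set.inclusion hS'S) (Set.inclusion_injective hS'S)
  · have e : {j : Fin (d + 1) // j ≠ i} ≃ T := Fintype.equivOfCardEq (by simp [hTcard])
    have := DiffIndep.of_specialization D (le_diffAdjoin D)
      (fun x hx => derivation_mem_diffAdjoin D hF hx) hu
      (y := fun i α => monValue D (s i) (m i) ξ α) (fun i α => monValue_mem_diffAdjoin D _ _ ξ α)
      (fun j : {j : Fin (d + 1) // j ≠ i} => j.1) (fun j => GenMon.single _ _ (hm j) (e j).1)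
      Subtype.val_injective (by
        simp_rw [monValue_single]
        exact hTindep.comp e.injective)
    simpa only [hζ] using this
end
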